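/- arXiv:1712.07139 — 2 statements merged into one kernel-verified Lean document; each statement's English description precedes it below -/
import Mathlib

section
/- Let X be a complete metric space, n ≥ 1 an integer, and S ⊆ X an n-rectifiable set with H^n(S) > 0. Then for any finite-dimensional real Banach space V with dim V ≥ n and any L > 0, the set {f ∈ Lip(X,V,L) : H^n(f(S)) > 0} is open and dense in Lip(X,V,L). -/
open MeasureTheory Metric Set Filter
open scoped NNReal ENNReal Topology

noncomputable section

/-- A set `E` in a metric space is `n`-rectifiable if it is `H^n`-measurable and can be covered,
up to an `H^n`-null set, by countably many Lipschitz images of subsets of `ℝ^n`. -/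
def IsRectifiable {X : Type*} [MetricSpace X] [MeasurableSpace X] [BorelSpace X]
    (n : ℕ) (E : Set X) : Prop :=
  NullMeasurableSet E μH[(n : ℝ)] ∧
    ∃ (A : ℕ → Set (EuclideanSpace ℝ (Fin n))) (f : ℕ → EuclideanSpace ℝ (Fin n) → X),
      (∀ i, ∃ K : ℝ≥0, LipschitzOnWith K (f i) (A i)) ∧
      μH[(n : ℝ)] (E \ ⋃ i, f i '' A i) = 0

/-- A set `S` is purely `n`-unrectifiable if every `n`-rectifiable set meets it
in an `H^n`-null set. -/
def PurelyUnrectifiable {X : Type*} [MetricSpace X] [MeasurableSpace X] [BorelSpace X]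
    (n : ℕ) (S : Set X) : Prop :=
  ∀ E : Set X, IsRectifiable n E → μH[(n : ℝ)] (S ∩ E) = 0

/-- `Lip(X,Y,L)`: the space of bounded `L`-Lipschitz functions `X → Y` with the
supremum distance. -/
def LipSpace (X Y : Type*) [MetricSpace X] [MetricSpace Y] (L : ℝ≥0) : Type _ :=
  {f : BoundedContinuousFunction X Y // LipschitzWith L ⇑f}

instance {X Y : Type*} [MetricSpace X] [MetricSpace Y] {L : ℝ≥0} :
    MetricSpace (LipSpace X Y L) :=
  inferInstanceAs (MetricSpace {f : BoundedContinuousFunction X Y // LipschitzWith L ⇑f})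

/-- If `f` maps the points of `s` into a null set, where `f` is differentiable with invertible
derivative at every point of `s`, then `s` is null. -/
theorem measure_eq_zero_of_image_null {E : Type*} [NormedAddCommGroup E] [NormedSpace ℝ E]
    [FiniteDimensional ℝ E] [MeasurableSpace E] [BorelSpace E] (μ : Measure E)
    [μ.IsAddHaarMeasure] {f : E → E} (hf : Continuous f) {s : Set E}
    (hdiff : ∀ x ∈ s, DifferentiableAt ℝ f x) (hdet : ∀ x ∈ s, (fderiv ℝ f x).det ≠ 0)
    (hnull : μ (f '' s) = 0) : μ s = 0 := by
  obtain ⟨N, hN, hNm, hN0⟩ := exists_measurable_superset_of_null hnull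
  have hdetm : Measurable fun x ↦ (fderiv ℝ f x).det :=
    ContinuousLinearMap.continuous_det.measurable.comp (measurable_fderiv ℝ f)
  set S : Set E := {x | DifferentiableAt ℝ f x ∧ (fderiv ℝ f x).det ≠ 0 ∧ f x ∈ N} with hS
  have hSm : MeasurableSet S :=
    (measurableSet_of_differentiableAt ℝ f).inter
      ((hdetm (measurableSet_singleton 0).compl).inter (hf.measurable hNm))
  refine measure_mono_null (t := S)
    (fun x hx ↦ ⟨hdiff x hx, hdet x hx, hN (mem_image_of_mem f hx)⟩) ?_
  have hder : ∀ x ∈ S, HasFDerivWithinAt f (fderiv ℝ f x) S x :=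
    fun x hx ↦ hx.1.hasFDerivAt.hasFDerivWithinAt
  classical
  rcases S.eq_empty_or_nonempty with hSe | hSne
  · simp [hSe]
  obtain ⟨t, A, -, htm, hSt, happ, hA⟩ :=
    exists_partition_approximatesLinearOn_of_hasFDerivWithinAt f S (fderiv ℝ f) hder
      (fun A ↦ if h : A.det ≠ 0 then
        if Subsingleton E then 1 else
          ‖((A.toContinuousLinearEquivOfDetNeZero h).symm : E →L[ℝ] E)‖₊⁻¹ / 2 else 1)
      (by
        intro A
        split_ifs with h h'
        · exact one_ne_zero
        · have : Nontrivial E := not_subsingleton_iff_nontrivial.1 h'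
          have := (A.toContinuousLinearEquivOfDetNeZero h).symm.nnnorm_symm_pos
          have := (A.toContinuousLinearEquivOfDetNeZero h).nnnorm_symm_pos
          positivity
        · exact one_ne_zero)
  have key : ∀ i, μ (S ∩ t i) = 0 := by
    intro i
    obtain ⟨y, hy, hAy⟩ := hA hSne i
    have hAdet : (A i).det ≠ 0 := hAy ▸ hy.2.1
    have hinj : InjOn f (S ∩ t i) := by
      have h1 := happ i
      rw [dif_pos hAdet] at h1
      refine ApproximatesLinearOn.injOn
        (f' := (A i).toContinuousLinearEquivOfDetNeZero hAdet) h1 ?_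
      by_cases h' : Subsingleton E
      · exact Or.inl h'
      · right
        have : Nontrivial E := not_subsingleton_iff_nontrivial.1 h'
        rw [if_neg h']
        have := ((A i).toContinuousLinearEquivOfDetNeZero hAdet).nnnorm_symm_pos
        exact NNReal.half_lt_self (by positivity)
    have hm : MeasurableSet (S ∩ t i) := hSm.inter (htm i)
    have h0 : ∫⁻ x in S ∩ t i, ENNReal.ofReal |(fderiv ℝ f x).det| ∂μ = 0 := by
      rw [lintegral_abs_det_fderiv_eq_addHaar_image μ hm
        (fun x hx ↦ (hder x hx.1).mono inter_subset_left) hinj]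
      refine measure_mono_null ?_ hN0
      rintro _ ⟨x, hx, rfl⟩
      exact hx.1.2.2
    rw [setLIntegral_eq_zero_iff hm (by fun_prop)] at h0
    rw [← compl_compl (S ∩ t i), ← mem_ae_iff]
    filter_upwards [h0] with x hx hxi
    have := hx hxi
    simp only [ENNReal.ofReal_eq_zero, abs_nonpos_iff] at this
    exact hxi.1.2.1 this
  have : S = ⋃ i, S ∩ t i := by rw [← inter_iUnion, inter_eq_left.2 hSt]
  rw [this]
  exact measure_iUnion_null key

/-- For a family of uniformly Lipschitz functions on the line, almost every point at which all
derivatives are bounded by `ε` is a point at which all small increments are controlled. -/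
theorem ae_uniform_increment_real {γ : ℕ → ℝ → ℝ} {K : ℝ≥0} (hγ : ∀ j, LipschitzWith K (γ j))
    {ε : ℝ} (hε : 0 < ε) :
    ∀ᵐ t, (∀ j, |deriv (γ j) t| ≤ ε) →
      ∃ m : ℕ, ∀ h : ℝ, |h| < 1 / (m + 1) → ∀ j, |γ j (t + h) - γ j t| ≤ 2 * ε * |h| := by
  set G : Set ℝ := {t | ∀ j, |deriv (γ j) t| ≤ ε} with hG
  have hGm : MeasurableSet G := by
    rw [hG, Set.ofPred_forall]
    exact MeasurableSet.iInter fun j ↦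
      measurableSet_le (measurable_deriv (γ j)).abs measurable_const
  filter_upwards [Besicovitch.ae_tendsto_measure_inter_div_of_measurableSet volume hGm.compl]
    with t ht htG
  have htG' : t ∈ G := htG
  rw [indicator_of_notMem (by simpa using htG')] at ht
  have hc : 0 < ENNReal.ofReal (ε / (2 * (K + 1))) := ENNReal.ofReal_pos.2 (by positivity)
  have hev := ht.eventually (gt_mem_nhds hc)
  rw [eventually_nhdsWithin_iff, Metric.eventually_nhds_iff] at hev
  obtain ⟨δ, hδ, hev⟩ := hev
  obtain ⟨m, hm⟩ := exists_nat_one_div_lt hδ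
  refine ⟨m, fun h hh j ↦ ?_⟩
  rcases eq_or_ne h 0 with rfl | h0
  · simp
  have hpos : 0 < |h| := abs_pos.2 h0
  have hdens := hev (y := |h|) (by simpa using hh.trans hm) hpos
  rw [Real.volume_closedBall] at hdens
  have hvol : volume.real (Gᶜ ∩ closedBall t |h|) ≤ ε / (K + 1) * |h| := by
    have h1 := (ENNReal.div_lt_iff (Or.inl (by simpa using hpos.ne'))
      (Or.inl ENNReal.ofReal_ne_top)).1 hdens
    rw [← ENNReal.ofReal_mul (by positivity)] at h1
    refine (ENNReal.toReal_mono ENNReal.ofReal_ne_top h1.le).trans ?_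
    rw [ENNReal.toReal_ofReal (by positivity)]
    apply le_of_eq
    field_simp
  have hintegral : γ j (t + h) - γ j t = ∫ x in t..(t + h), deriv (γ j) x :=
    ((hγ j).lipschitzOnWith.absolutelyContinuousOnInterval).integral_deriv_eq_sub.symm
  have hsub : uIoc t (t + h) ⊆ closedBall t |h| := by
    intro x hx
    have := uIoc_subset_uIcc hx
    rw [Real.closedBall_eq_Icc]
    rcases le_total 0 h with hh | hh
    · rw [uIcc_of_le (by linarith)] at this
      rw [abs_of_nonneg hh]
      constructor <;> linarith [this.1, this.2]
    · rw [uIcc_of_ge (by linarith)] at this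
      rw [abs_of_nonpos hh]
      constructor <;> linarith [this.1, this.2]
  have hfin : volume (uIoc t (t + h)) ≠ ∞ := by simp [uIoc]
  have hK : ∀ x, |deriv (γ j) x| ≤ K := fun x ↦ by
    simpa using norm_deriv_le_of_lipschitz (x₀ := x) (hγ j)
  have hI : IntegrableOn (fun x ↦ ε + (Gᶜ).indicator (fun _ ↦ (K : ℝ)) x) (uIoc t (t + h)) := by
    refine (integrableOn_const hfin).add (IntegrableOn.indicator ?_ hGm.compl)
    exact integrableOn_const hfin
  have hI' : IntegrableOn (fun x ↦ |deriv (γ j) x|) (uIoc t (t + h)) :=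
    Measure.integrableOn_of_bounded (M := K) hfin
      (measurable_deriv (γ j)).abs.aestronglyMeasurable
      (Eventually.of_forall fun x ↦ by simpa using hK x)
  calc |γ j (t + h) - γ j t| ≤ ∫ x in uIoc t (t + h), |deriv (γ j) x| := by
        rw [hintegral]
        exact intervalIntegral.norm_integral_le_integral_norm_uIoc (E := ℝ)
    _ ≤ ∫ x in uIoc t (t + h), (ε + (Gᶜ).indicator (fun _ ↦ (K : ℝ)) x) := by
        refine setIntegral_mono hI' hI fun x ↦ ?_
        by_cases hx : x ∈ G
        · simpa [hx] using hx j
        · have : x ∈ Gᶜ := hx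
          simp only [indicator_of_mem this]
          linarith [hK x]
    _ = ε * |h| + K * volume.real (Gᶜ ∩ uIoc t (t + h)) := by
        have h1 : IntegrableOn (fun _ : ℝ ↦ ε) (uIoc t (t + h)) := integrableOn_const hfin
        have h2 : IntegrableOn ((Gᶜ).indicator fun _ ↦ (K : ℝ)) (uIoc t (t + h)) :=
          IntegrableOn.indicator (integrableOn_const hfin) hGm.compl
        rw [integral_add h1 h2,
          integral_indicator hGm.compl, setIntegral_const, setIntegral_const, measureReal_def,
          Real.volume_uIoc, measureReal_def, Measure.restrict_apply hGm.compl,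
          measureReal_def]
        simp [mul_comm]
    _ ≤ ε * |h| + K * (ε / (K + 1) * |h|) := by
        gcongr
        refine le_trans (measureReal_mono (inter_subset_inter_right _ hsub) ?_) hvol
        exact ((measure_mono inter_subset_right).trans_lt measure_closedBall_lt_top).ne
    _ ≤ 2 * ε * |h| := by
        have : (K : ℝ) * (ε / (K + 1)) ≤ ε := by
          rw [mul_div_assoc', div_le_iff₀ (by positivity)]
          nlinarith [K.2]
        nlinarith

/-- A version of `ae_uniform_increment_real` along a fixed direction. -/
theorem ae_uniform_increment {E : Type*} [NormedAddCommGroup E] [NormedSpace ℝ E]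
    [FiniteDimensional ℝ E] [MeasurableSpace E] [BorelSpace E] (μ : Measure E)
    [μ.IsAddHaarMeasure] {u : ℕ → E → ℝ} {K : ℝ≥0} (hu : ∀ j, LipschitzWith K (u j))
    {ε : ℝ} (hε : 0 < ε) (v : E) :
    ∀ᵐ x ∂μ, (∀ j, |lineDeriv ℝ (u j) x v| ≤ ε) →
      ∃ m : ℕ, ∀ h : ℝ, |h| < 1 / (m + 1) → ∀ j, |u j (x + h • v) - u j x| ≤ 2 * ε * |h| := by
  set s : Set E := {x | (∀ j, |lineDeriv ℝ (u j) x v| ≤ ε) →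
      ∃ m : ℕ, ∀ h : ℝ, |h| < 1 / (m + 1) → ∀ j, |u j (x + h • v) - u j x| ≤ 2 * ε * |h|}
    with hs
  have hsm : MeasurableSet s := by
    refine MeasurableSet.imp ?_ ?_
    · rw [Set.ofPred_forall]
      exact MeasurableSet.iInter fun j ↦
        measurableSet_le (measurable_lineDeriv (hu j).continuous).abs measurable_const
    · rw [Set.ofPred_exists]
      refine MeasurableSet.iUnion fun m ↦ IsClosed.measurableSet ?_
      simp only [Set.ofPred_forall]
      refine isClosed_iInter fun h ↦ isClosed_iInter fun _ ↦ isClosed_iInter fun j ↦ ?_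
      have := (hu j).continuous
      exact isClosed_le (by fun_prop) continuous_const
  refine ae_mem_of_ae_add_linearMap_mem (LinearMap.toSpanSingleton ℝ E v) volume μ hsm
    fun y ↦ ?_
  have hγ : ∀ j, LipschitzWith (K * ‖v‖₊) fun t : ℝ ↦ u j (y + t • v) := by
    intro j
    refine (hu j).comp (LipschitzWith.of_dist_le_mul fun a b ↦ ?_)
    rw [dist_add_left, dist_eq_norm, ← sub_smul, norm_smul, mul_comm, dist_eq_norm]
    rfl
  filter_upwards [ae_uniform_increment_real hγ hε] with t ht
  intro hd
  have hderiv : ∀ j, deriv (fun t : ℝ ↦ u j (y + t • v)) t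
      = lineDeriv ℝ (u j) (y + t • v) v := by
    intro j
    rw [lineDeriv]
    have := deriv_comp_const_add (f := fun t : ℝ ↦ u j (y + t • v)) t 0
    rw [add_zero] at this
    rw [← this]
    simp only [add_smul, add_assoc]
  obtain ⟨m, hm⟩ := ht fun j ↦ by rw [hderiv]; exact hd j
  refine ⟨m, fun h hh j ↦ ?_⟩
  have := hm h hh j
  simpa only [add_smul, ← add_assoc, LinearMap.toSpanSingleton_apply] using this

/-- Lipschitz self-maps of a finite-dimensional space send null sets to null sets. -/
theorem addHaar_image_eq_zero_of_lipschitz {E : Type*} [NormedAddCommGroup E] [NormedSpace ℝ E]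
    [FiniteDimensional ℝ E] [MeasurableSpace E] [BorelSpace E] (μ : Measure E)
    [μ.IsAddHaarMeasure] {f : E → E} {K : ℝ≥0} (hf : LipschitzWith K f) {s : Set E}
    (hs : μ s = 0) : μ (f '' s) = 0 := by
  have h1 : μH[(Module.finrank ℝ E : ℝ)] s = 0 := by
    rw [Measure.isAddLeftInvariant_eq_smul μH[(Module.finrank ℝ E : ℝ)] μ]
    simp [hs]
  have h2 : μH[(Module.finrank ℝ E : ℝ)] (f '' s) = 0 := by
    have := hf.hausdorffMeasure_image_le (d := Module.finrank ℝ E) (by positivity) s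
    simpa [h1] using this
  rw [Measure.isAddLeftInvariant_eq_smul μ μH[(Module.finrank ℝ E : ℝ)]]
  simp [h2]

/-- The determinant is polynomial along lines. -/
theorem exists_polynomial_det_add_smul {E : Type*} [NormedAddCommGroup E] [NormedSpace ℝ E]
    [FiniteDimensional ℝ E] (A M : E →L[ℝ] E) :
    ∃ P : Polynomial ℝ, P.natDegree ≤ Module.finrank ℝ E ∧
      P.coeff (Module.finrank ℝ E) = M.det ∧ ∀ t : ℝ, P.eval t = (A + t • M).det := by
  set b := Module.finBasis ℝ E
  set A' := LinearMap.toMatrix b b A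
  set M' := LinearMap.toMatrix b b M
  refine ⟨Matrix.det ((Polynomial.X : Polynomial ℝ) • M'.map Polynomial.C
    + A'.map Polynomial.C), ?_, ?_, fun t ↦ ?_⟩
  · simpa using Polynomial.natDegree_det_X_add_C_le M' A'
  · have := Polynomial.coeff_det_X_add_C_card M' A'
    rw [Fintype.card_fin] at this
    rw [this, ContinuousLinearMap.det, LinearMap.det_toMatrix]
  · rw [ContinuousLinearMap.det, ← LinearMap.det_toMatrix b, ← Polynomial.coe_evalRingHom,
      RingHom.map_det]
    congr 1
    ext i j
    simp [A', M']
    ring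

/-- A Lipschitz perturbation of the identity supported in a ball has average Jacobian one. -/
theorem integral_det_id_add_fderiv {E : Type*} [NormedAddCommGroup E] [NormedSpace ℝ E]
    [FiniteDimensional ℝ E] [MeasurableSpace E] [BorelSpace E] (μ : Measure E)
    [μ.IsAddHaarMeasure] {φ : E → E} {K : ℝ≥0} (hφ : LipschitzWith K φ) {a : E} {r : ℝ}
    (hsupp : ∀ x ∉ closedBall a r, φ x = 0) :
    ∫ x in closedBall a r, (ContinuousLinearMap.id ℝ E + fderiv ℝ φ x).det ∂μ
      = μ.real (closedBall a r) := by
  have hdetc : Continuous fun A : E →L[ℝ] E ↦ (ContinuousLinearMap.id ℝ E + A).det :=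
    ContinuousLinearMap.continuous_det.comp (continuous_const.add continuous_id)
  have hbound : ∀ x, ‖fderiv ℝ φ x‖ ≤ K := fun x ↦ norm_fderiv_le_of_lipschitz ℝ hφ
  have hmeas : ∀ t : ℝ,
      Measurable fun x ↦ (ContinuousLinearMap.id ℝ E + t • fderiv ℝ φ x).det := fun t ↦
    hdetc.measurable.comp ((measurable_fderiv ℝ φ).const_smul t)
  have hintegral : ∀ t : ℝ, IntegrableOn
      (fun x ↦ (ContinuousLinearMap.id ℝ E + t • fderiv ℝ φ x).det) (closedBall a r) μ := by
    intro t
    obtain ⟨C, hC⟩ := (isCompact_closedBall (0 : E →L[ℝ] E) (|t| * K)).exists_bound_of_continuousOn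
      hdetc.continuousOn
    refine Measure.integrableOn_of_bounded (M := C) measure_closedBall_lt_top.ne
      (hmeas t).aestronglyMeasurable (Eventually.of_forall fun x ↦ hC _ ?_)
    rw [mem_closedBall_zero_iff, norm_smul, Real.norm_eq_abs]
    gcongr
    exact hbound x
  have hpos : ∀ᶠ A in 𝓝 (0 : E →L[ℝ] E), 0 < (ContinuousLinearMap.id ℝ E + A).det := by
    refine hdetc.continuousAt.eventually (lt_mem_nhds ?_)
    simp [ContinuousLinearMap.det]
  rw [Metric.eventually_nhds_iff] at hpos
  obtain ⟨δ, hδ, hpos⟩ := hpos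
  have hsmall : ∀ t : ℝ, 0 < t → t * (K + 1) < min δ 1 →
      ∫ x in closedBall a r, (ContinuousLinearMap.id ℝ E + t • fderiv ℝ φ x).det ∂μ
        = μ.real (closedBall a r) := by
    intro t ht htK
    have htK1 : t * K < δ := by nlinarith [htK.trans_le (min_le_left δ 1)]
    have htK2 : t * K < 1 := by nlinarith [htK.trans_le (min_le_right δ 1)]
    have hdetpos : ∀ x, 0 < (ContinuousLinearMap.id ℝ E + t • fderiv ℝ φ x).det := by
      intro x
      refine hpos ?_
      rw [dist_zero_right, norm_smul, Real.norm_eq_abs, abs_of_pos ht]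
      exact (mul_le_mul_of_nonneg_left (hbound x) ht.le).trans_lt htK1
    lift t to ℝ≥0 using ht.le
    set h : E → E := fun x ↦ x + (t : ℝ) • φ x with hh
    have hlip : LipschitzWith (1 + t * K) h := by
      refine LipschitzWith.id.add (LipschitzWith.of_dist_le_mul fun x y ↦ ?_)
      rw [dist_smul₀, Real.norm_eq_abs, abs_of_pos ht, NNReal.coe_mul, mul_assoc]
      exact mul_le_mul_of_nonneg_left (hφ.dist_le_mul x y) ht.le
    have happ : ApproximatesLinearOn h
        ((ContinuousLinearEquiv.refl ℝ E : E ≃L[ℝ] E) : E →L[ℝ] E) univ (t * K) := by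
      intro x _ y _
      have : h x - h y - ((ContinuousLinearEquiv.refl ℝ E : E ≃L[ℝ] E) : E →L[ℝ] E) (x - y)
          = (t : ℝ) • (φ x - φ y) := by
        simp only [hh, ContinuousLinearEquiv.coe_refl, ContinuousLinearMap.coe_id', id, smul_sub]
        abel
      rw [this, norm_smul, Real.norm_eq_abs, abs_of_pos ht, NNReal.coe_mul, mul_assoc]
      refine mul_le_mul_of_nonneg_left ?_ ht.le
      simpa [dist_eq_norm] using hφ.dist_le_mul x y
    have hc : Subsingleton E ∨ t * K <
        ‖((ContinuousLinearEquiv.refl ℝ E).symm : E →L[ℝ] E)‖₊⁻¹ := by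
      rcases subsingleton_or_nontrivial E with hE | hE
      · exact Or.inl hE
      · right
        have : ‖((ContinuousLinearEquiv.refl ℝ E).symm : E →L[ℝ] E)‖₊ = 1 := by
          simp
        rw [this, inv_one, ← NNReal.coe_lt_coe]
        exact htK2
    have hinj : Function.Injective h := injOn_univ.1 (happ.injOn hc)
    have hsurj : Function.Surjective h := happ.surjective hc
    have hout : ∀ x ∉ closedBall a r, h x = x := fun x hx ↦ by simp [hh, hsupp x hx]
    have himage : h '' closedBall a r = closedBall a r := by
      apply Subset.antisymm
      · rintro _ ⟨x, hx, rfl⟩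
        by_contra hn
        exact hn ((hinj (hout _ hn)).symm ▸ hx)
      · intro y hy
        obtain ⟨x, rfl⟩ := hsurj y
        by_cases hx : x ∈ closedBall a r
        · exact mem_image_of_mem h hx
        · exact absurd (hout x hx ▸ hy) hx
    set D : Set E := closedBall a r ∩ {x | DifferentiableAt ℝ φ x} with hD
    have hDm : MeasurableSet D :=
      measurableSet_closedBall.inter (measurableSet_of_differentiableAt ℝ φ)
    have hnull : μ (closedBall a r \ D) = 0 := by
      refine measure_mono_null ?_ (ae_iff.1 (hφ.ae_differentiableAt (μ := μ)))
      rintro x ⟨hx, hxD⟩ hd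
      exact hxD ⟨hx, hd⟩
    have hDimage : μ (h '' D) = μ (closedBall a r) := by
      refine le_antisymm ?_ ?_
      · rw [← himage]
        exact measure_mono (by rw [himage]; exact (image_mono inter_subset_left).trans himage.subset)
      · calc μ (closedBall a r) ≤ μ (h '' D ∪ h '' (closedBall a r \ D)) := by
              refine measure_mono ?_
              rw [← image_union, union_sdiff_cancel inter_subset_left, himage]
          _ ≤ μ (h '' D) + μ (h '' (closedBall a r \ D)) := measure_union_le _ _
          _ = μ (h '' D) := by
              rw [addHaar_image_eq_zero_of_lipschitz μ hlip hnull, add_zero]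
    have hcov : ∫⁻ x in D, ENNReal.ofReal
        |(ContinuousLinearMap.id ℝ E + (t : ℝ) • fderiv ℝ φ x).det| ∂μ = μ (h '' D) := by
      refine lintegral_abs_det_fderiv_eq_addHaar_image μ hDm (fun x hx ↦ ?_) hinj.injOn
      exact ((hasFDerivAt_id x).add (hx.2.hasFDerivAt.const_smul t)).hasFDerivWithinAt
    have hBD : closedBall a r =ᵐ[μ] D := by
      refine (ae_eq_set.2 ⟨hnull, ?_⟩)
      rw [sdiff_eq_empty.2 inter_subset_left, measure_empty]
    rw [setIntegral_congr_set hBD, integral_eq_lintegral_of_nonneg_ae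
      (Eventually.of_forall fun x ↦ (hdetpos x).le) (hmeas t).aestronglyMeasurable]
    simp only [abs_of_pos (hdetpos _)] at hcov
    rw [hcov, hDimage]
    rfl
  set n := Module.finrank ℝ E
  set c : ℝ := min δ 1 / (2 * (K + 1)) with hc
  have hcpos : 0 < c := by positivity
  set τ : ℕ → ℝ := fun i ↦ c / (i + 1) with hτ
  have hτpos : ∀ i, 0 < τ i := fun i ↦ by positivity
  have hτsmall : ∀ i, τ i * (K + 1) < min δ 1 := by
    intro i
    have h1 : τ i ≤ c := div_le_self hcpos.le (by norm_cast; omega)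
    have h2 : c * (K + 1) = min δ 1 / 2 := by rw [hc]; field_simp
    have h3 : 0 < min δ 1 := by positivity
    calc τ i * (K + 1) ≤ c * (K + 1) := by gcongr
      _ < min δ 1 := by rw [h2]; linarith
  have hτinj : InjOn τ (Finset.range (n + 1)) := by
    intro i _ j _ hij
    simp only [hτ] at hij
    rw [div_eq_div_iff (by positivity) (by positivity)] at hij
    have := mul_left_cancel₀ hcpos.ne' hij
    exact_mod_cast (add_right_cancel this).symm
  set w : ℕ → ℝ := fun i ↦ (Lagrange.basis (Finset.range (n + 1)) τ i).eval 1 with hw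
  have hwsum : ∑ i ∈ Finset.range (n + 1), w i = 1 := by
    have := congrArg (Polynomial.eval 1) (Lagrange.sum_basis hτinj ⟨0, by simp⟩)
    simpa [Polynomial.eval_finsetSum] using this
  have hinterp : ∀ x, (ContinuousLinearMap.id ℝ E + fderiv ℝ φ x).det
      = ∑ i ∈ Finset.range (n + 1),
        w i * (ContinuousLinearMap.id ℝ E + τ i • fderiv ℝ φ x).det := by
    intro x
    obtain ⟨P, hPdeg, -, hP⟩ :=
      exists_polynomial_det_add_smul (ContinuousLinearMap.id ℝ E) (fderiv ℝ φ x)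
    have h1 := Lagrange.eq_interpolate hτinj (f := P) (by
      rw [Finset.card_range]
      exact (Polynomial.degree_le_of_natDegree_le hPdeg).trans_lt
        (by exact_mod_cast Nat.lt_succ_self n))
    have h2 := congrArg (Polynomial.eval 1) h1
    rw [hP 1, one_smul, Lagrange.interpolate_apply, Polynomial.eval_finsetSum] at h2
    rw [h2]
    refine Finset.sum_congr rfl fun i _ ↦ ?_
    simp [hw, hP, mul_comm]
  calc ∫ x in closedBall a r, (ContinuousLinearMap.id ℝ E + fderiv ℝ φ x).det ∂μ
      = ∑ i ∈ Finset.range (n + 1), w i *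
        ∫ x in closedBall a r, (ContinuousLinearMap.id ℝ E + τ i • fderiv ℝ φ x).det ∂μ := by
        simp only [hinterp]
        rw [integral_finsetSum _ fun i _ ↦ (hintegral (τ i)).const_mul (w i)]
        simp only [integral_const_mul]
    _ = ∑ i ∈ Finset.range (n + 1), w i * μ.real (closedBall a r) :=
        Finset.sum_congr rfl fun i _ ↦ by rw [hsmall (τ i) (hτpos i) (hτsmall i)]
    _ = μ.real (closedBall a r) := by rw [← Finset.sum_mul, hwsum, one_mul]

/-- If a Lipschitz perturbation of the identity supported in a ball squashes a subset `G` of the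
ball to a null set, then `G` cannot fill most of the ball. -/
theorem exists_measureReal_le_of_image_null {E : Type*} [NormedAddCommGroup E] [NormedSpace ℝ E]
    [FiniteDimensional ℝ E] [MeasurableSpace E] [BorelSpace E] (μ : Measure E)
    [μ.IsAddHaarMeasure] (K : ℝ≥0) :
    ∃ D : ℝ, 0 < D ∧ ∀ (φ : E → E) (a : E) (r : ℝ) (G : Set E), LipschitzWith K φ →
      (∀ x ∉ closedBall a r, φ x = 0) → G ⊆ closedBall a r →
      μ ((fun x ↦ x + φ x) '' G) = 0 →
      μ.real (closedBall a r) ≤ D * (μ.real (closedBall a r) - μ.real G) := by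
  have hdetc : Continuous fun A : E →L[ℝ] E ↦ (ContinuousLinearMap.id ℝ E + A).det :=
    ContinuousLinearMap.continuous_det.comp (continuous_const.add continuous_id)
  obtain ⟨C, hC⟩ := (isCompact_closedBall (0 : E →L[ℝ] E) K).exists_bound_of_continuousOn
      hdetc.continuousOn
  refine ⟨max C 1, by positivity, fun φ a r G hφ hsupp hG hnull ↦ ?_⟩
  set B := closedBall a r
  have hBfin : μ B ≠ ∞ := measure_closedBall_lt_top.ne
  set J : E → ℝ := fun x ↦ (ContinuousLinearMap.id ℝ E + fderiv ℝ φ x).det with hJ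
  have hJm : Measurable J := hdetc.measurable.comp (measurable_fderiv ℝ φ)
  have hJb : ∀ x, ‖J x‖ ≤ max C 1 := fun x ↦ (hC _ (by
    rw [mem_closedBall_zero_iff]; exact norm_fderiv_le_of_lipschitz ℝ hφ)).trans (le_max_left _ _)
  set Z : Set E := {x | J x = 0} with hZ
  have hZm : MeasurableSet Z := hJm (measurableSet_singleton 0)
  have hGZ : μ (G \ Z) = 0 := by
    have h1 : μ ((G \ Z) ∩ {x | DifferentiableAt ℝ φ x}) = 0 := by
      have hd : ∀ x ∈ (G \ Z) ∩ {x | DifferentiableAt ℝ φ x},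
          HasFDerivAt (fun x ↦ x + φ x) (ContinuousLinearMap.id ℝ E + fderiv ℝ φ x) x :=
        fun x hx ↦ (hasFDerivAt_id x).add hx.2.hasFDerivAt
      refine measure_eq_zero_of_image_null μ (f := fun x ↦ x + φ x)
        (continuous_id.add hφ.continuous) (fun x hx ↦ (hd x hx).differentiableAt)
        (fun x hx ↦ ?_) (measure_mono_null (image_mono fun x hx ↦ hx.1.1) hnull)
      rw [(hd x hx).fderiv]
      exact hx.1.2
    have h2 : μ {x | ¬ DifferentiableAt ℝ φ x} = 0 := ae_iff.1 (hφ.ae_differentiableAt (μ := μ))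
    refine measure_mono_null (fun x hx ↦ ?_) (measure_union_null h1 h2)
    by_cases hxd : DifferentiableAt ℝ φ x
    · exact Or.inl ⟨hx, hxd⟩
    · exact Or.inr hxd
  have hintegral := integral_det_id_add_fderiv μ hφ hsupp
  have hI : IntegrableOn J B μ :=
    Measure.integrableOn_of_bounded hBfin hJm.aestronglyMeasurable (Eventually.of_forall hJb)
  have hle : μ.real B ≤ max C 1 * μ.real (B \ Z) := by
    rw [← hintegral, ← integral_inter_add_sdiff hZm hI]
    have h0 : ∫ x in B ∩ Z, J x ∂μ = 0 :=
      setIntegral_eq_zero_of_forall_eq_zero fun x hx ↦ hx.2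
    rw [h0, zero_add]
    refine (le_abs_self _).trans ?_
    exact norm_setIntegral_le_of_norm_le_const
      ((measure_mono sdiff_subset).trans_lt hBfin.lt_top) (fun x _ ↦ hJb x)
  refine hle.trans (mul_le_mul_of_nonneg_left ?_ (by positivity))
  have h1 : μ.real G ≤ μ.real (B ∩ Z) := by
    refine ENNReal.toReal_mono ((measure_mono inter_subset_left).trans_lt hBfin.lt_top).ne ?_
    calc μ G ≤ μ (G ∩ Z ∪ G \ Z) := measure_mono (by rw [inter_union_sdiff])
      _ ≤ μ (G ∩ Z) + μ (G \ Z) := measure_union_le _ _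
      _ ≤ μ (B ∩ Z) := by rw [hGZ, add_zero]; exact measure_mono (by gcongr)
  have h2 := measureReal_inter_add_sdiff (μ := μ) (s := B) hZm hBfin
  linarith

theorem exists_measureReal_le_of_near_id {E : Type*} [NormedAddCommGroup E] [NormedSpace ℝ E]
    [FiniteDimensional ℝ E] [MeasurableSpace E] [BorelSpace E] (μ : Measure E)
    [μ.IsAddHaarMeasure] (K : ℝ≥0) :
    ∃ D : ℝ, 0 < D ∧ ∀ (h : E → E) (A : Set E) (a : E) (r s : ℝ), LipschitzOnWith K h A →
      A ⊆ closedBall a s → s ≤ r → (∀ x ∈ A, ‖h x - x‖ ≤ r - s) → μ (h '' A) = 0 →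
      μ.real (closedBall a r) ≤ D * (μ.real (closedBall a r) - μ.real A) := by
  obtain ⟨D, hD, H⟩ := exists_measureReal_le_of_image_null μ
    (lipschitzExtensionConstant E * (K + 1))
  refine ⟨D, hD, fun h A a r s hh hA hsr hnear hnull ↦ ?_⟩
  classical
  set φ₀ : E → E := fun x ↦ if x ∈ closedBall a r then h x - x else 0 with hφ₀
  have hAr : A ⊆ closedBall a r := hA.trans (closedBall_subset_closedBall hsr)
  have hcross : ∀ x ∈ A, ∀ y ∈ (closedBall a r)ᶜ,
      dist (φ₀ x) (φ₀ y) ≤ (K + 1 : ℝ≥0) * dist x y := by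
    intro x hx y hy
    have hx' := hA hx
    simp only [mem_compl_iff, mem_closedBall, not_le] at hx' hy
    have h1 : φ₀ x = h x - x := if_pos (hAr hx)
    have h2 : φ₀ y = 0 := if_neg (by simpa using hy)
    rw [h1, h2, dist_zero_right]
    have h3 : r - s ≤ dist x y := by
      have := dist_triangle y x a
      rw [dist_comm y x] at this
      linarith
    have h4 := (hnear x hx).trans h3
    have h5 : 0 ≤ (K : ℝ) * dist x y := by positivity
    push_cast
    linarith
  have hφ₀lip : LipschitzOnWith (K + 1) φ₀ (A ∪ (closedBall a r)ᶜ) := by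
    refine LipschitzOnWith.of_dist_le_mul ?_
    rintro x (hx | hx) y (hy | hy)
    · have h1 : φ₀ x = h x - x := if_pos (hAr hx)
      have h2 : φ₀ y = h y - y := if_pos (hAr hy)
      rw [h1, h2]
      refine (dist_sub_sub_le _ _ _ _).trans ?_
      have := hh.dist_le_mul x hx y hy
      push_cast
      linarith
    · exact hcross x hx y hy
    · rw [dist_comm, dist_comm x]
      exact hcross y hy x hx
    · have h1 : φ₀ x = 0 := if_neg hx
      have h2 : φ₀ y = 0 := if_neg hy
      rw [h1, h2, dist_self]
      positivity
  obtain ⟨φ, hφ, heq⟩ := hφ₀lip.extend_finite_dimension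
  refine H φ a r A hφ (fun x hx ↦ ?_) hAr ?_
  · rw [← heq (Or.inr hx)]
    exact if_neg hx
  · have : (fun x ↦ x + φ x) '' A = h '' A := by
      refine image_congr fun x hx ↦ ?_
      have h1 : φ₀ x = h x - x := if_pos (hAr hx)
      rw [← heq (Or.inl hx), h1, add_sub_cancel]
    rw [this, hnull]

/-- Positivity of the measure of an image is stable under perturbations with a uniform Lipschitz
constant of a map with invertible differential. -/
theorem exists_image_pos_of_near {E : Type*} [NormedAddCommGroup E] [NormedSpace ℝ E]
    [FiniteDimensional ℝ E] [MeasurableSpace E] [BorelSpace E] (μ : Measure E)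
    [μ.IsAddHaarMeasure] {A : Set E} (hA : 0 < μ A) {P : E → E}
    (hdiff : ∀ x ∈ A, DifferentiableAt ℝ P x) (hdet : ∀ x ∈ A, (fderiv ℝ P x).det ≠ 0)
    (C : ℝ≥0) :
    ∃ η : ℝ, 0 < η ∧ ∀ h : E → E, LipschitzOnWith C h A → (∀ x ∈ A, ‖h x - P x‖ ≤ η) →
      0 < μ (h '' A) := by
  obtain ⟨a, haA, hdens⟩ : ∃ a ∈ A,
      Tendsto (fun r ↦ μ (A ∩ closedBall a r) / μ (closedBall a r)) (𝓝[>] 0) (𝓝 1) := by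
    by_contra! hcon
    have h1 := ae_iff.1 (Besicovitch.ae_tendsto_measure_inter_div μ A)
    have h2 := le_trans (Measure.le_restrict_apply A _) h1.le
    refine hA.ne' (le_antisymm (le_trans (measure_mono fun x hx ↦ ?_) h2) zero_le)
    exact ⟨hcon x hx, hx⟩
  set M := (fderiv ℝ P a).toContinuousLinearEquivOfDetNeZero (hdet a haA) with hM
  have hMcoe : ∀ x, M x = fderiv ℝ P a x := fun x ↦ by simp [hM]
  set N : E →L[ℝ] E := (M.symm : E →L[ℝ] E)
  obtain ⟨D, hD, H⟩ := exists_measureReal_le_of_near_id μ (‖N‖₊ * C)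
  set d := Module.finrank ℝ E
  obtain ⟨θ, hθ0, hθ1, hθ⟩ : ∃ θ : ℝ, 0 < θ ∧ θ < 1 ∧ D * (1 - (1 - θ) * (1 - θ) ^ d) < 1 := by
    have hc : ContinuousAt (fun θ : ℝ ↦ D * (1 - (1 - θ) * (1 - θ) ^ d)) 0 := by fun_prop
    have h1 : ∀ᶠ θ in 𝓝[>] (0 : ℝ), D * (1 - (1 - θ) * (1 - θ) ^ d) < 1 :=
      nhdsWithin_le_nhds (hc.eventually (gt_mem_nhds (by simp)))
    have h2 : ∀ᶠ θ in 𝓝[>] (0 : ℝ), θ < 1 := nhdsWithin_le_nhds (gt_mem_nhds one_pos)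
    obtain ⟨θ, ⟨h3, h4⟩, h5⟩ := ((h1.and h2).and self_mem_nhdsWithin).exists
    exact ⟨θ, h5, h4, h3⟩
  set ε : ℝ := θ / (2 * (‖N‖ + 1)) with hε
  have hεpos : 0 < ε := by positivity
  have hεN : ‖N‖ * ε ≤ θ / 2 := by
    rw [hε, mul_div_assoc', div_le_div_iff₀ (by positivity) (by norm_num)]
    nlinarith [norm_nonneg N]
  have hder : ∀ᶠ x in 𝓝 a, ‖P x - P a - fderiv ℝ P a (x - a)‖ ≤ ε * ‖x - a‖ :=
    (hdiff a haA).hasFDerivAt.isLittleO.bound hεpos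
  obtain ⟨δ, hδ, hder⟩ := Metric.eventually_nhds_iff.1 hder
  have hdens' : ∀ᶠ r in 𝓝[>] (0 : ℝ), ENNReal.ofReal (1 - θ) <
      μ (A ∩ closedBall a r) / μ (closedBall a r) :=
    hdens.eventually (lt_mem_nhds (by
      rw [← ENNReal.ofReal_one]; exact (ENNReal.ofReal_lt_ofReal_iff one_pos).2 (by linarith)))
  obtain ⟨s, ⟨hs, hsδ⟩, hs0⟩ := ((hdens'.and
    (nhdsWithin_le_nhds (gt_mem_nhds (show (0 : ℝ) < (1 - θ) * δ / 2 by nlinarith)))).and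
    self_mem_nhdsWithin).exists
  have hs0 : 0 < s := hs0
  set r := s / (1 - θ) with hr
  have h1θ : 0 < 1 - θ := by linarith
  have hr0 : 0 < r := by positivity
  have hsr : s = (1 - θ) * r := by rw [hr]; field_simp
  have hrδ : r < δ := by
    rw [hr, div_lt_iff₀ h1θ]
    nlinarith
  have hballs : μ.real (closedBall a s) = (1 - θ) ^ d * μ.real (closedBall a r) := by
    rw [Measure.addHaar_real_closedBall μ a hs0.le, Measure.addHaar_real_closedBall μ a hr0.le,
      hsr, mul_pow, mul_assoc]
  have hGreal : (1 - θ) * μ.real (closedBall a s) ≤ μ.real (A ∩ closedBall a s) := by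
    have h1 := hs.le
    rw [ENNReal.le_div_iff_mul_le (Or.inl (measure_closedBall_pos μ a hs0).ne')
      (Or.inl measure_closedBall_lt_top.ne)] at h1
    have h2 := ENNReal.toReal_mono
      ((measure_mono inter_subset_right).trans_lt measure_closedBall_lt_top).ne h1
    rwa [ENNReal.toReal_mul, ENNReal.toReal_ofReal h1θ.le] at h2
  refine ⟨ε * r, by positivity, fun h hh hnear ↦ pos_iff_ne_zero.2 fun hzero ↦ ?_⟩
  set G := A ∩ closedBall a s with hG
  set h₀ : E → E := fun x ↦ N (h x - P a) + a with hh₀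
  have hkey := H h₀ G a r s ?_ inter_subset_right (by nlinarith) ?_ ?_
  · have hBpos : 0 < μ.real (closedBall a r) :=
      ENNReal.toReal_pos (measure_closedBall_pos μ a hr0).ne' measure_closedBall_lt_top.ne
    rw [hballs] at hGreal
    have : D * (μ.real (closedBall a r) - μ.real G) ≤
        D * (1 - (1 - θ) * (1 - θ) ^ d) * μ.real (closedBall a r) := by
      rw [mul_assoc]
      refine mul_le_mul_of_nonneg_left ?_ hD.le
      linarith
    nlinarith
  · refine LipschitzOnWith.of_dist_le_mul fun x hx y hy ↦ ?_
    have : h₀ x - h₀ y = N (h x - h y) := by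
      simp only [hh₀, map_sub]; abel
    rw [dist_eq_norm, this, NNReal.coe_mul, mul_assoc]
    refine (N.le_opNorm _).trans (mul_le_mul_of_nonneg_left ?_ (norm_nonneg _))
    rw [← dist_eq_norm]
    exact hh.dist_le_mul x hx.1 y hy.1
  · intro x hx
    have hxs : ‖x - a‖ ≤ s := by simpa [dist_eq_norm] using hx.2
    have hxr : ‖x - a‖ ≤ r := hxs.trans (by nlinarith)
    have h1 : h₀ x - x = N ((h x - P x) + (P x - P a - fderiv ℝ P a (x - a))) := by
      have h2 : N (fderiv ℝ P a (x - a)) = x - a := by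
        rw [← hMcoe]; exact M.symm_apply_apply _
      have h3 : (h x - P x) + (P x - P a - fderiv ℝ P a (x - a))
          = (h x - P a) - fderiv ℝ P a (x - a) := by abel
      rw [h3, map_sub, h2]
      simp only [hh₀]
      abel
    have h4 : ‖P x - P a - fderiv ℝ P a (x - a)‖ ≤ ε * ‖x - a‖ :=
      hder (by rw [dist_eq_norm]; exact hxr.trans_lt hrδ)
    have h5 : ‖(h x - P x) + (P x - P a - fderiv ℝ P a (x - a))‖ ≤ ε * r + ε * r := by
      refine (norm_add_le _ _).trans (add_le_add (hnear x hx.1) (h4.trans ?_))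
      gcongr
    rw [h1]
    calc _ ≤ ‖N‖ * (ε * r + ε * r) := (N.le_opNorm _).trans (by gcongr)
      _ = ‖N‖ * ε * (2 * r) := by ring
      _ ≤ θ / 2 * (2 * r) := by gcongr
      _ = r - s := by rw [hsr]; ring
  · have hsub : h₀ '' G ⊆ (fun y ↦ N (y - P a) + a) '' (h '' A) := by
      rintro _ ⟨x, hx, rfl⟩
      exact ⟨h x, mem_image_of_mem h hx.1, rfl⟩
    refine measure_mono_null hsub (addHaar_image_eq_zero_of_lipschitz μ (K := ‖N‖₊) ?_ hzero)
    refine LipschitzWith.of_dist_le_mul fun x y ↦ ?_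
    have : (N (x - P a) + a) - (N (y - P a) + a) = N (x - y) := by
      simp only [map_sub]; abel
    rw [dist_eq_norm, this, dist_eq_norm]
    exact N.le_opNorm _

/-- A map that is nearly constant in the direction `v` at small scale shrinks the Hausdorff
measure by a factor comparable to `ε`. -/
theorem hausdorffMeasure_image_le_of_flat {E : Type*} [NormedAddCommGroup E]
    [InnerProductSpace ℝ E] [FiniteDimensional ℝ E] [MeasurableSpace E] [BorelSpace E]
    {X : Type*} [MetricSpace X] [MeasurableSpace X] [BorelSpace X] {u : E → X} {Z : Set E}
    {v : E} (hv : ‖v‖ = 1) {ε : ℝ} (hε : 0 < ε) (hε1 : ε ≤ 1) {K : ℝ≥0}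
    (h : ∀ p ∈ Z, ∀ q ∈ Z, dist (u p) (u q) ≤
      2 * ε * |inner ℝ v (q - p)| + K * ‖q - p - inner ℝ v (q - p) • v‖) :
    μH[(Module.finrank ℝ E : ℝ)] (u '' Z) ≤
      ENNReal.ofReal ((4 + K) ^ Module.finrank ℝ E * ε) * μH[(Module.finrank ℝ E : ℝ)] Z := by
  set d := Module.finrank ℝ E with hd
  have hvv : inner ℝ v v = (1 : ℝ) := by rw [real_inner_self_eq_norm_sq, hv]; norm_num
  set T : E →ₗ[ℝ] E := ε • LinearMap.transvection (ε⁻¹ • innerₗ E v) v with hT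
  have hTapp : ∀ z, T z = ε • z + (inner ℝ v z : ℝ) • v := by
    intro z
    simp only [hT, LinearMap.smul_apply, LinearMap.transvection.apply, smul_add, smul_smul,
      innerₗ_apply_apply, smul_eq_mul]
    rw [mul_inv_cancel_left₀ hε.ne']
  have hTdet : LinearMap.det T = ε ^ d * (1 + ε⁻¹) := by
    rw [hT, LinearMap.det_smul, LinearMap.transvection.det]
    simp [hv, hd]
  have hTdet0 : 0 < LinearMap.det T := by rw [hTdet]; positivity
  have hlip : LipschitzOnWith (Real.toNNReal ((4 + K) * ε)) (u ∘ T) (T ⁻¹' Z) := by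
    refine LipschitzOnWith.of_dist_le_mul fun x hx y hy ↦ ?_
    rw [Real.coe_toNNReal _ (by positivity), dist_comm x y, dist_eq_norm]
    refine (h _ hx _ hy).trans ?_
    rw [← map_sub]
    set z := y - x
    have hin : |inner ℝ v z| ≤ ‖z‖ := by
      simpa [hv] using abs_real_inner_le_norm v z
    have ht : inner ℝ v (T z) = (1 + ε) * inner ℝ v z := by
      rw [hTapp, inner_add_right, inner_smul_right, inner_smul_right, hvv]
      ring
    have hw : T z - inner ℝ v (T z) • v = ε • (z - (inner ℝ v z : ℝ) • v) := by
      rw [ht, hTapp]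
      module
    have hn : ‖z - (inner ℝ v z : ℝ) • v‖ ≤ ‖z‖ := by
      rw [← sq_le_sq₀ (norm_nonneg _) (norm_nonneg _), norm_sub_sq_real, inner_smul_right,
        real_inner_comm, norm_smul, hv, Real.norm_eq_abs, mul_one, sq_abs]
      nlinarith [sq_nonneg (inner ℝ v z : ℝ)]
    rw [hw, ht, norm_smul, Real.norm_eq_abs, abs_of_pos hε, abs_mul, abs_of_pos (by linarith)]
    have hK : (0 : ℝ) ≤ K := K.2
    have h1 : 2 * ε * ((1 + ε) * |inner ℝ v z|) ≤ 2 * ε * (2 * ‖z‖) := by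
      gcongr
      linarith
    have h2 : (K : ℝ) * (ε * ‖z - (inner ℝ v z : ℝ) • v‖) ≤ K * (ε * ‖z‖) := by gcongr
    linarith
  have himg : u '' Z ⊆ (u ∘ T) '' (T ⁻¹' Z) := by
    rintro _ ⟨z, hz, rfl⟩
    obtain ⟨y, rfl⟩ := (LinearMap.equivOfDetNeZero T hTdet0.ne').surjective z
    exact ⟨y, hz, rfl⟩
  calc μH[(d : ℝ)] (u '' Z) ≤ μH[(d : ℝ)] ((u ∘ T) '' (T ⁻¹' Z)) := measure_mono himg
    _ ≤ (Real.toNNReal ((4 + K) * ε) : ℝ≥0∞) ^ (d : ℝ) * μH[(d : ℝ)] (T ⁻¹' Z) :=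
        hlip.hausdorffMeasure_image_le (by positivity)
    _ = ENNReal.ofReal (((4 + K) * ε) ^ d * (LinearMap.det T)⁻¹) * μH[(d : ℝ)] Z := by
        rw [Measure.addHaar_preimage_linearMap μH[(d : ℝ)] hTdet0.ne', abs_of_pos (by positivity),
          ENNReal.rpow_natCast, ENNReal.ofReal_mul (by positivity),
          ENNReal.ofReal_pow (by positivity), mul_assoc]
        rfl
    _ ≤ _ := by
        have hle : ((4 + K) * ε) ^ d * (LinearMap.det T)⁻¹ ≤ (4 + K) ^ d * ε := by
          have h1 : (1 + ε⁻¹)⁻¹ ≤ ε := by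
            rw [inv_le_comm₀ (by positivity) hε]
            linarith
          rw [hTdet, mul_pow, mul_inv, mul_assoc, mul_inv_cancel_left₀ (by positivity)]
          gcongr
        gcongr

/-- A metric version of Sard's theorem: the points at which a countable family of functions
controlling the metric has a common kernel direction are mapped to a null set. -/
theorem hausdorffMeasure_image_eq_zero_of_kernel {E : Type*} [NormedAddCommGroup E]
    [InnerProductSpace ℝ E] [FiniteDimensional ℝ E] [MeasurableSpace E] [BorelSpace E]
    {X : Type*} [MetricSpace X] [MeasurableSpace X] [BorelSpace X] {u : E → X} {A Z : Set E}
    {U : ℕ → E → ℝ} {K : ℝ≥0} (hU : ∀ j, LipschitzWith K (U j))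
    (hdist : ∀ a ∈ A, ∀ b ∈ A, ∀ c : ℝ, (∀ j, |U j b - U j a| ≤ c) → dist (u a) (u b) ≤ c)
    (hZA : Z ⊆ A)
    (hZ : ∀ x ∈ Z, (∀ j, DifferentiableAt ℝ (U j) x) ∧
      ∃ v : E, ‖v‖ = 1 ∧ ∀ j, fderiv ℝ (U j) x v = 0) :
    μH[(Module.finrank ℝ E : ℝ)] (u '' Z) = 0 := by
  set d := Module.finrank ℝ E with hd
  wlog hbdd : ∃ R : ℝ, Z ⊆ ball 0 R generalizing Z
  · have hcov : u '' Z ⊆ ⋃ R : ℕ, u '' (Z ∩ ball 0 R) := by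
      rintro _ ⟨z, hz, rfl⟩
      obtain ⟨R, hR⟩ := exists_nat_gt ‖z‖
      exact mem_iUnion.2 ⟨R, z, ⟨hz, by simpa using hR⟩, rfl⟩
    refine measure_mono_null hcov (measure_iUnion_null fun R ↦ ?_)
    exact this (inter_subset_left.trans hZA) (fun x hx ↦ hZ x hx.1) ⟨R, inter_subset_right⟩
  obtain ⟨R, hR⟩ := hbdd
  rcases Z.eq_empty_or_nonempty with rfl | ⟨z₀, hz₀⟩
  · simp
  obtain ⟨v₀, hv₀, -⟩ := (hZ z₀ hz₀).2
  have hne : Nonempty (sphere (0 : E) 1) := ⟨⟨v₀, by simpa using hv₀⟩⟩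
  have hu : LipschitzOnWith K u A := LipschitzOnWith.of_dist_le_mul fun a ha b hb ↦
    hdist a ha b hb _ fun j ↦ by
      have := (hU j).dist_le_mul b a
      rwa [Real.dist_eq, dist_comm b a] at this
  set w : ℕ → E := fun k ↦ (TopologicalSpace.denseSeq (sphere (0 : E) 1) k : E) with hw
  have hw1 : ∀ k, ‖w k‖ = 1 := fun k ↦ by
    exact mem_sphere_zero_iff_norm.1 (TopologicalSpace.denseSeq (sphere (0 : E) 1) k).2
  set c : ℕ → E := TopologicalSpace.denseSeq E
  have key : ∀ ε : ℝ, 0 < ε → ε ≤ 1 → μH[(d : ℝ)] (u '' Z) ≤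
      ENNReal.ofReal ((4 + K) ^ d * ε) * μH[(d : ℝ)] (ball (0 : E) R) := by
    intro ε hε hε1
    set G : ℕ × ℕ × ℕ → Set E := fun q ↦
      (⋂ (t : ℝ) (_ : |t| < 1 / (q.2.1 + 1)) (j : ℕ),
        {x | |U j (x + t • w q.1) - U j x| ≤ 2 * ε * |t|}) ∩
      (ball (c q.2.2) (1 / (2 * (q.2.1 + 1))) ∩ ball 0 R) with hG
    have hGm : ∀ q, MeasurableSet (G q) := by
      intro q
      refine MeasurableSet.inter (IsClosed.measurableSet ?_)
        (measurableSet_ball.inter measurableSet_ball)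
      refine isClosed_iInter fun t ↦ isClosed_iInter fun _ ↦ isClosed_iInter fun j ↦ ?_
      have hc := (hU j).continuous
      exact isClosed_le (by fun_prop) continuous_const
    set F : ℕ → Set E := fun i ↦ G (Denumerable.ofNat (ℕ × ℕ × ℕ) i) with hF
    have hpiece : ∀ i, μH[(d : ℝ)] (u '' (Z ∩ disjointed F i)) ≤
        ENNReal.ofReal ((4 + K) ^ d * ε) * μH[(d : ℝ)] (disjointed F i) := by
      intro i
      set q := Denumerable.ofNat (ℕ × ℕ × ℕ) i with hq
      refine (hausdorffMeasure_image_le_of_flat (hw1 q.1) hε hε1 (K := K) ?_).trans ?_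
      · intro x hx y hy
        have hx' : x ∈ G q := disjointed_subset F i hx.2
        have hy' : y ∈ G q := disjointed_subset F i hy.2
        refine hdist x (hZA hx.1) y (hZA hy.1) _ fun j ↦ ?_
        set t : ℝ := inner ℝ (w q.1) (y - x)
        have ht : |t| < 1 / (q.2.1 + 1) := by
          have h1 : |t| ≤ ‖y - x‖ := by
            simpa [hw1] using abs_real_inner_le_norm (w q.1) (y - x)
          have h2 := mem_ball.1 hx'.2.1
          have h3 := mem_ball.1 hy'.2.1
          have h4 := dist_triangle_right y x (c q.2.2)
          rw [dist_eq_norm] at h4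
          have h5 : 1 / (2 * ((q.2.1 : ℝ) + 1)) + 1 / (2 * ((q.2.1 : ℝ) + 1))
            = 1 / (q.2.1 + 1) := by field_simp; norm_num
          linarith
        have h1 : |U j (x + t • w q.1) - U j x| ≤ 2 * ε * |t| := by
          have := hx'.1
          simp only [mem_iInter] at this
          exact this t ht j
        have h2 : |U j y - U j (x + t • w q.1)| ≤ K * ‖y - x - t • w q.1‖ := by
          have := (hU j).dist_le_mul y (x + t • w q.1)
          rwa [Real.dist_eq, dist_eq_norm, ← sub_sub] at this
        have h3 := abs_sub_le (U j y) (U j (x + t • w q.1)) (U j x)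
        linarith
      · gcongr
        exact inter_subset_right
    set N : Set E := {x | ¬ ∀ k, (∀ j, |lineDeriv ℝ (U j) x (w k)| ≤ ε) → ∃ m : ℕ,
        ∀ h : ℝ, |h| < 1 / (m + 1) → ∀ j, |U j (x + h • w k) - U j x| ≤ 2 * ε * |h|} with hN
    have hN0 : μH[(d : ℝ)] N = 0 :=
      ae_iff.1 (ae_all_iff.2 fun k ↦ ae_uniform_increment μH[(d : ℝ)] hU hε (w k))
    have huN : μH[(d : ℝ)] (u '' (Z ∩ N)) = 0 := by
      have h1 := (hu.mono (inter_subset_left.trans hZA : Z ∩ N ⊆ A)).hausdorffMeasure_image_le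
        (d := d) (by positivity)
      rw [measure_mono_null inter_subset_right hN0, mul_zero] at h1
      exact le_antisymm h1 zero_le
    have hcov : Z \ N ⊆ ⋃ i, disjointed F i := by
      rintro x ⟨hxZ, hxN⟩
      rw [hN, notMem_ofPred_iff, not_not] at hxN
      obtain ⟨hdx, v, hv, hv0⟩ := hZ x hxZ
      obtain ⟨k, hk⟩ := (TopologicalSpace.denseRange_denseSeq (sphere (0 : E) 1)).exists_dist_lt
        ⟨v, by simpa using hv⟩ (show 0 < ε / (K + 1) by positivity)
      have hk' : ‖w k - v‖ < ε / (K + 1) := by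
        rw [Subtype.dist_eq, dist_comm, dist_eq_norm] at hk
        exact hk
      obtain ⟨m, hm⟩ := hxN k fun j ↦ by
        rw [(hdx j).lineDeriv_eq_fderiv]
        have h1 : fderiv ℝ (U j) x (w k) = fderiv ℝ (U j) x (w k - v) := by
          rw [map_sub, hv0 j, sub_zero]
        rw [h1]
        refine ((fderiv ℝ (U j) x).le_opNorm _).trans ?_
        have h2 := norm_fderiv_le_of_lipschitz ℝ (hU j) (x₀ := x)
        have h3 : (K : ℝ) * (ε / (K + 1)) ≤ ε := by
          rw [mul_div_assoc', div_le_iff₀ (by positivity)]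
          nlinarith
        exact (mul_le_mul h2 hk'.le (norm_nonneg _) K.2).trans h3
      obtain ⟨i, hi⟩ := (TopologicalSpace.denseRange_denseSeq E).exists_dist_lt x
        (show (0 : ℝ) < 1 / (2 * (m + 1)) by positivity)
      rw [iUnion_disjointed, mem_iUnion]
      refine ⟨Encodable.encode (k, m, i), ?_⟩
      simp only [hF, Denumerable.ofNat_encode, hG]
      refine ⟨?_, hi, hR hxZ⟩
      simp only [mem_iInter]
      exact fun t ht j ↦ hm t ht j
    have hsplit : u '' Z ⊆ u '' (Z ∩ N) ∪ ⋃ i, u '' (Z ∩ disjointed F i) := by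
      rintro _ ⟨x, hx, rfl⟩
      by_cases hxN : x ∈ N
      · exact Or.inl ⟨x, ⟨hx, hxN⟩, rfl⟩
      · obtain ⟨i, hi⟩ := mem_iUnion.1 (hcov ⟨hx, hxN⟩)
        exact Or.inr (mem_iUnion.2 ⟨i, x, ⟨hx, hi⟩, rfl⟩)
    calc μH[(d : ℝ)] (u '' Z)
        ≤ μH[(d : ℝ)] (u '' (Z ∩ N)) + μH[(d : ℝ)] (⋃ i, u '' (Z ∩ disjointed F i)) :=
          (measure_mono hsplit).trans (measure_union_le _ _)
      _ ≤ ∑' i, μH[(d : ℝ)] (u '' (Z ∩ disjointed F i)) := by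
          rw [huN, zero_add]; exact measure_iUnion_le _
      _ ≤ ∑' i, ENNReal.ofReal ((4 + K) ^ d * ε) * μH[(d : ℝ)] (disjointed F i) :=
          ENNReal.tsum_le_tsum hpiece
      _ = ENNReal.ofReal ((4 + K) ^ d * ε) * μH[(d : ℝ)] (⋃ i, disjointed F i) := by
          rw [ENNReal.tsum_mul_left, measure_iUnion (disjoint_disjointed F)
            fun i ↦ MeasurableSet.disjointed (fun i ↦ hGm _) i]
      _ ≤ _ := by
          gcongr
          rw [iUnion_disjointed]
          exact iUnion_subset fun i ↦ inter_subset_right.trans inter_subset_right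
  have hlim : Tendsto (fun ε : ℝ ↦ ENNReal.ofReal ((4 + K) ^ d * ε) *
      μH[(d : ℝ)] (ball (0 : E) R)) (𝓝[>] 0) (𝓝 0) := by
    have h1 : Tendsto (fun ε : ℝ ↦ ENNReal.ofReal ((4 + K) ^ d * ε)) (𝓝[>] 0) (𝓝 0) := by
      have h2 : ContinuousAt (fun ε : ℝ ↦ ENNReal.ofReal ((4 + K) ^ d * ε)) 0 :=
        (ENNReal.continuous_ofReal.comp (continuous_const.mul continuous_id)).continuousAt
      have h3 := h2.tendsto.mono_left (nhdsWithin_le_nhds (s := Ioi 0))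
      simpa using h3
    have h4 := ENNReal.Tendsto.mul_const h1 (b := μH[(d : ℝ)] (ball (0 : E) R))
      (Or.inr measure_ball_lt_top.ne)
    rwa [zero_mul] at h4
  refine le_antisymm (ge_of_tendsto hlim ?_) zero_le
  filter_upwards [self_mem_nhdsWithin, nhdsWithin_le_nhds (gt_mem_nhds one_pos)] with ε h1 h2
  exact key ε h1 h2.le

theorem isAddHaarMeasure_hausdorffMeasure_euclideanSpace (n : ℕ) :
    (μH[(n : ℝ)] : Measure (EuclideanSpace ℝ (Fin n))).IsAddHaarMeasure := by
  have := isAddHaarMeasure_hausdorffMeasure (E := EuclideanSpace ℝ (Fin n))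
  rwa [finrank_euclideanSpace_fin] at this

theorem exists_lipschitzWith_toLp {Y : Type*} [PseudoMetricSpace Y] {n : ℕ} {f : Fin n → Y → ℝ}
    {K : ℝ≥0} (hf : ∀ i, LipschitzWith K (f i)) :
    ∃ K' : ℝ≥0, LipschitzWith K'
      (fun y ↦ WithLp.toLp 2 (fun i ↦ f i y) : Y → EuclideanSpace ℝ (Fin n)) := by
  have h1 : LipschitzWith K fun y ↦ fun i ↦ f i y :=
    LipschitzWith.of_dist_le_mul fun x y ↦
      (dist_pi_le_iff (by positivity)).2 fun i ↦ (hf i).dist_le_mul x y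
  exact ⟨_, (PiLp.lipschitzWith_toLp 2 fun _ : Fin n ↦ ℝ).comp h1⟩

/-- Among countably many functionals, as many as the dimension suffice to cut out the common
kernel. -/
theorem exists_fin_common_kernel {E : Type*} [AddCommGroup E] [Module ℝ E]
    [FiniteDimensional ℝ E] {n : ℕ} (hn : Module.finrank ℝ E = n) (f : ℕ → E →ₗ[ℝ] ℝ) :
    ∃ g : Fin n → ℕ, ∀ v, (∀ i, f (g i) v = 0) → ∀ j, f j v = 0 := by
  obtain ⟨b, hb, hspan, -⟩ := Submodule.exists_fun_fin_finrank_span_eq ℝ (range f)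
  choose k hk using hb
  have hmn : Module.finrank ℝ (Submodule.span ℝ (range f)) ≤ n := by
    rw [← hn, ← Subspace.dual_finrank_eq (K := ℝ) (V := E)]
    exact Submodule.finrank_le _
  refine ⟨fun i ↦ if h : (i : ℕ) < Module.finrank ℝ (Submodule.span ℝ (range f)) then k ⟨i, h⟩ else 0,
    fun v hv j ↦ ?_⟩
  have hb0 : ∀ i, b i v = 0 := fun i ↦ by
    have := hv ⟨i, i.2.trans_le hmn⟩
    simpa [hk] using this
  have hle : Submodule.span ℝ (range b) ≤ LinearMap.ker (Module.Dual.eval ℝ E v) := by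
    rw [Submodule.span_le]
    rintro _ ⟨i, rfl⟩
    exact hb0 i
  rw [hspan] at hle
  exact hle (Submodule.subset_span (mem_range_self j))

/-- A Lipschitz map with image of positive `n`-dimensional measure can be composed with a
Lipschitz map into Euclidean space so that the result has invertible differential on a set of
positive measure. -/
theorem exists_lipschitz_chart {X : Type*} [MetricSpace X] [MeasurableSpace X] [BorelSpace X]
    {n : ℕ} {A : Set (EuclideanSpace ℝ (Fin n))} {u : EuclideanSpace ℝ (Fin n) → X} {K : ℝ≥0}
    (hu : LipschitzOnWith K u A) (hpos : 0 < μH[(n : ℝ)] (u '' A)) :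
    ∃ (p : X → EuclideanSpace ℝ (Fin n))
      (P : EuclideanSpace ℝ (Fin n) → EuclideanSpace ℝ (Fin n))
      (A' : Set (EuclideanSpace ℝ (Fin n))),
      (∃ C, LipschitzWith C p) ∧ (∃ M, ∀ x, ‖p x‖ ≤ M) ∧ (∃ C, LipschitzWith C P) ∧ A' ⊆ A ∧
      (∀ x ∈ A', P x = p (u x)) ∧ 0 < μH[(n : ℝ)] A' ∧
      (∀ x ∈ A', DifferentiableAt ℝ P x) ∧ ∀ x ∈ A', (fderiv ℝ P x).det ≠ 0 := by
  have hHaar := isAddHaarMeasure_hausdorffMeasure_euclideanSpace n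
  wlog hbdd : ∃ R : ℝ, A ⊆ ball 0 R generalizing A
  · have hcov : u '' A ⊆ ⋃ R : ℕ, u '' (A ∩ ball 0 R) := by
      rintro _ ⟨z, hz, rfl⟩
      obtain ⟨R, hR⟩ := exists_nat_gt ‖z‖
      exact mem_iUnion.2 ⟨R, z, ⟨hz, by simpa using hR⟩, rfl⟩
    obtain ⟨R, hR⟩ : ∃ R : ℕ, 0 < μH[(n : ℝ)] (u '' (A ∩ ball 0 R)) := by
      by_contra! hcon
      exact hpos.ne' (measure_mono_null hcov
        (measure_iUnion_null fun R ↦ le_antisymm (hcon R) zero_le))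
    obtain ⟨p, P, A', h1, h2, h3, h4, h5⟩ :=
      this (hu.mono inter_subset_left) hR ⟨R, inter_subset_right⟩
    exact ⟨p, P, A', h1, h2, h3, h4.trans inter_subset_left, h5⟩
  obtain ⟨R, hR⟩ := hbdd
  have hAne : Nonempty A := by
    rcases A.eq_empty_or_nonempty with rfl | h
    · simp at hpos
    · exact h.to_subtype
  have hnull : ∀ s ⊆ A, μH[(n : ℝ)] s = 0 → μH[(n : ℝ)] (u '' s) = 0 := by
    intro s hs hs0
    have h1 := (hu.mono hs).hausdorffMeasure_image_le (d := n) (by positivity)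
    rw [hs0, mul_zero] at h1
    exact le_antisymm h1 zero_le
  set M : ℝ := K * (R + R) with hM
  have hdiam : ∀ a ∈ A, ∀ b ∈ A, dist (u a) (u b) ≤ M := by
    intro a ha b hb
    refine (hu.dist_le_mul a ha b hb).trans (mul_le_mul_of_nonneg_left ?_ K.2)
    exact (dist_triangle_right a b 0).trans (add_le_add (hR ha).le (hR hb).le)
  have hM0 : 0 ≤ M := by
    obtain ⟨a, ha⟩ := hAne
    exact dist_nonneg.trans (hdiam a ha a ha)
  set a : ℕ → EuclideanSpace ℝ (Fin n) := fun j ↦ (TopologicalSpace.denseSeq A j : _) with ha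
  have haA : ∀ j, a j ∈ A := fun j ↦ (TopologicalSpace.denseSeq A j).2
  set c : ℕ → X → ℝ := fun j x ↦ min (dist x (u (a j))) M with hc
  have hclip : ∀ j, LipschitzWith 1 (c j) := fun j ↦
    (LipschitzWith.dist_left (u (a j))).min_const M
  have hcA : ∀ j, ∀ x ∈ A, c j (u x) = dist (u x) (u (a j)) := fun j x hx ↦
    min_eq_left (hdiam x hx _ (haA j))
  have hext : ∀ j, ∃ g : EuclideanSpace ℝ (Fin n) → ℝ, LipschitzWith K g ∧ EqOn (c j ∘ u) g A :=
    fun j ↦ by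
      have := (hclip j).comp_lipschitzOnWith hu
      rw [one_mul] at this
      exact this.extend_real
  choose U hU hUeq using hext
  have hdist : ∀ x ∈ A, ∀ y ∈ A, ∀ r : ℝ, (∀ j, |U j y - U j x| ≤ r) → dist (u x) (u y) ≤ r := by
    intro x hx y hy r hr
    refine le_of_forall_pos_le_add fun δ hδ ↦ ?_
    obtain ⟨j, hj⟩ := (TopologicalSpace.denseRange_denseSeq A).exists_dist_lt ⟨x, hx⟩
      (show 0 < δ / 2 / (K + 1) by positivity)
    have hj' : dist (u x) (u (a j)) ≤ δ / 2 := by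
      refine (hu.dist_le_mul x hx _ (haA j)).trans ?_
      have h1 : dist x (a j) ≤ δ / 2 / (K + 1) := hj.le
      have h2 : (K : ℝ) * (δ / 2 / (K + 1)) ≤ δ / 2 := by
        rw [mul_div_assoc', div_le_iff₀ (by positivity)]
        nlinarith
      exact (mul_le_mul_of_nonneg_left h1 K.2).trans h2
    have h3 := hr j
    rw [← hUeq j hx, ← hUeq j hy, Function.comp_apply, Function.comp_apply, hcA j x hx,
      hcA j y hy] at h3
    have h4 := (abs_le.1 h3).2
    have h5 := dist_triangle_right (u x) (u y) (u (a j))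
    linarith
  set Z : Set (EuclideanSpace ℝ (Fin n)) := {x ∈ A | (∀ j, DifferentiableAt ℝ (U j) x) ∧
      ∃ v, ‖v‖ = 1 ∧ ∀ j, fderiv ℝ (U j) x v = 0} with hZ
  have hZ0 : μH[(n : ℝ)] (u '' Z) = 0 := by
    have := hausdorffMeasure_image_eq_zero_of_kernel (Z := Z) hU hdist (fun x hx ↦ hx.1)
      (fun x hx ↦ hx.2)
    rwa [finrank_euclideanSpace_fin] at this
  set N : Set (EuclideanSpace ℝ (Fin n)) := {x | ¬ ∀ j, DifferentiableAt ℝ (U j) x} with hN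
  have hN0 : μH[(n : ℝ)] N = 0 :=
    ae_iff.1 (ae_all_iff.2 fun j ↦ (hU j).ae_differentiableAt (μ := μH[(n : ℝ)]))
  set A₀ : Set (EuclideanSpace ℝ (Fin n)) := A \ (Z ∪ N) with hA₀
  have hA₀pos : μH[(n : ℝ)] A₀ ≠ 0 := by
    intro h0
    have hsplit : u '' A ⊆ u '' A₀ ∪ (u '' Z ∪ u '' (A ∩ N)) := by
      rintro _ ⟨x, hx, rfl⟩
      by_cases h1 : x ∈ Z
      · exact Or.inr (Or.inl ⟨x, h1, rfl⟩)
      by_cases h2 : x ∈ N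
      · exact Or.inr (Or.inr ⟨x, ⟨hx, h2⟩, rfl⟩)
      · exact Or.inl ⟨x, ⟨hx, fun h ↦ h.elim h1 h2⟩, rfl⟩
    refine hpos.ne' (measure_mono_null hsplit (measure_union_null ?_ (measure_union_null hZ0 ?_)))
    · exact hnull _ sdiff_subset h0
    · exact hnull _ inter_subset_left (measure_mono_null inter_subset_right hN0)
  have hA₀diff : ∀ x ∈ A₀, ∀ j, DifferentiableAt ℝ (U j) x := fun x hx ↦ by
    by_contra hcon
    exact hx.2 (Or.inr hcon)
  set Ag : (Fin n → ℕ) → Set (EuclideanSpace ℝ (Fin n)) := fun g ↦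
    {x ∈ A₀ | ∀ v, (∀ i, fderiv ℝ (U (g i)) x v = 0) → v = 0} with hAg
  have hcov : A₀ ⊆ ⋃ g, Ag g := by
    intro x hx
    obtain ⟨g, hg⟩ := exists_fin_common_kernel (n := n) (by simp)
      fun j ↦ (fderiv ℝ (U j) x : EuclideanSpace ℝ (Fin n) →ₗ[ℝ] ℝ)
    refine mem_iUnion.2 ⟨g, hx, fun v hv ↦ ?_⟩
    by_contra hv0
    refine hx.2 (Or.inl ⟨hx.1, hA₀diff x hx, ‖v‖⁻¹ • v, norm_smul_inv_norm hv0, fun j ↦ ?_⟩)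
    have : fderiv ℝ (U j) x v = 0 := hg v hv j
    rw [map_smul, this, smul_zero]
  obtain ⟨g, hg⟩ : ∃ g, μH[(n : ℝ)] (Ag g) ≠ 0 := by
    by_contra! hcon
    exact hA₀pos (measure_mono_null hcov (measure_iUnion_null hcon))
  have hPdiff : ∀ x ∈ Ag g, DifferentiableAt ℝ
      (fun y ↦ WithLp.toLp 2 (fun i ↦ U (g i) y) : _ → EuclideanSpace ℝ (Fin n)) x :=
    fun x hx ↦ differentiableAt_euclidean.2 fun i ↦ hA₀diff x hx.1 (g i)
  refine ⟨fun x ↦ WithLp.toLp 2 fun i ↦ c (g i) x, fun x ↦ WithLp.toLp 2 fun i ↦ U (g i) x, Ag g,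
    exists_lipschitzWith_toLp fun i ↦ hclip (g i), ?_, exists_lipschitzWith_toLp fun i ↦ hU (g i),
    fun x hx ↦ hx.1.1, fun x hx ↦ ?_, pos_iff_ne_zero.2 hg, hPdiff, fun x hx h0 ↦ ?_⟩
  · refine ⟨√(∑ _i : Fin n, M ^ 2), fun x ↦ ?_⟩
    rw [EuclideanSpace.norm_eq]
    refine Real.sqrt_le_sqrt (Finset.sum_le_sum fun i _ ↦ ?_)
    have h1 : 0 ≤ c (g i) x := le_min dist_nonneg hM0
    have h2 : c (g i) x ≤ M := min_le_right _ _
    rw [Real.norm_eq_abs, sq_abs]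
    exact pow_le_pow_left₀ h1 h2 2
  · ext i
    exact (hUeq (g i) hx.1.1).symm
  · obtain ⟨v, hv, hv0⟩ := (Submodule.ne_bot_iff _).1 (LinearMap.bot_lt_ker_of_det_eq_zero h0).ne'
    refine hv0 (hx.2 v fun i ↦ ?_)
    have h1 := ((EuclideanSpace.proj i : EuclideanSpace ℝ (Fin n) →L[ℝ] ℝ).hasFDerivAt.comp x
      (hPdiff x hx).hasFDerivAt).fderiv
    have h2 : fderiv ℝ (U (g i)) x v = EuclideanSpace.proj (𝕜 := ℝ) i (fderiv ℝ
      (fun y ↦ WithLp.toLp 2 (fun i ↦ U (g i) y) : _ → EuclideanSpace ℝ (Fin n)) x v) :=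
      DFunLike.congr_fun h1 v
    rw [h2]
    have h3 : fderiv ℝ
      (fun y ↦ WithLp.toLp 2 (fun i ↦ U (g i) y) : _ → EuclideanSpace ℝ (Fin n)) x v = 0 := hv
    rw [h3, map_zero]

/-- A Lipschitz image of positive measure of a rectifiable set is already seen on one Lipschitz
chart. -/
theorem IsRectifiable.exists_image_pos {X Y : Type*} [MetricSpace X] [MeasurableSpace X]
    [BorelSpace X] [MetricSpace Y] [MeasurableSpace Y] [BorelSpace Y] {n : ℕ} {S : Set X}
    (hS : IsRectifiable n S) {f : X → Y} {L : ℝ≥0} (hf : LipschitzWith L f)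
    (hpos : 0 < μH[(n : ℝ)] (f '' S)) :
    ∃ (A : Set (EuclideanSpace ℝ (Fin n))) (u : EuclideanSpace ℝ (Fin n) → X) (K : ℝ≥0),
      LipschitzOnWith K u A ∧ u '' A ⊆ S ∧ 0 < μH[(n : ℝ)] ((f ∘ u) '' A) := by
  obtain ⟨-, A, u, hu, hnull⟩ := hS
  have hcov : f '' S ⊆ f '' (S \ ⋃ i, u i '' A i) ∪ ⋃ i, (f ∘ u i) '' (A i ∩ u i ⁻¹' S) := by
    rintro _ ⟨x, hx, rfl⟩
    by_cases h : x ∈ ⋃ i, u i '' A i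
    · obtain ⟨i, y, hy, rfl⟩ := mem_iUnion.1 h
      exact Or.inr (mem_iUnion.2 ⟨i, y, ⟨hy, hx⟩, rfl⟩)
    · exact Or.inl ⟨x, ⟨hx, h⟩, rfl⟩
  have h0 : μH[(n : ℝ)] (f '' (S \ ⋃ i, u i '' A i)) = 0 := by
    have := hf.hausdorffMeasure_image_le (d := n) (by positivity) (S \ ⋃ i, u i '' A i)
    rw [hnull, mul_zero] at this
    exact le_antisymm this zero_le
  obtain ⟨i, hi⟩ : ∃ i, μH[(n : ℝ)] ((f ∘ u i) '' (A i ∩ u i ⁻¹' S)) ≠ 0 := by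
    by_contra! hcon
    exact hpos.ne' (measure_mono_null hcov (measure_union_null h0 (measure_iUnion_null hcon)))
  obtain ⟨K, hK⟩ := hu i
  refine ⟨A i ∩ u i ⁻¹' S, u i, K, hK.mono inter_subset_left, ?_, pos_iff_ne_zero.2 hi⟩
  rintro _ ⟨x, hx, rfl⟩
  exact hx.2

/-- Adding a suitable small multiple of a map with invertible differential to a Lipschitz map
makes the image have positive measure. -/
theorem exists_image_add_smul_pos {E : Type*} [NormedAddCommGroup E] [NormedSpace ℝ E]
    [FiniteDimensional ℝ E] [MeasurableSpace E] [BorelSpace E] (μ : Measure E)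
    [μ.IsAddHaarMeasure] {A : Set E} (hA : 0 < μ A) {F P : E → E} {K K' : ℝ≥0}
    (hF : LipschitzWith K F) (hP : LipschitzWith K' P)
    (hdiff : ∀ x ∈ A, DifferentiableAt ℝ P x) (hdet : ∀ x ∈ A, (fderiv ℝ P x).det ≠ 0)
    {s₀ : ℝ} (hs₀ : 0 < s₀) :
    ∃ s : ℝ, 0 < s ∧ s ≤ s₀ ∧ 0 < μ ((fun x ↦ F x + s • P x) '' A) := by
  set s : ℕ → ℝ := fun k ↦ s₀ / (k + 1) with hs
  have hspos : ∀ k, 0 < s k := fun k ↦ by positivity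
  have hsinj : Function.Injective s := by
    intro i j hij
    simp only [hs] at hij
    rw [div_eq_div_iff (by positivity) (by positivity)] at hij
    exact_mod_cast (add_right_cancel (mul_left_cancel₀ hs₀.ne' hij)).symm
  set N : Set E := {x | ¬ DifferentiableAt ℝ F x} with hN
  have hN0 : μ N = 0 := ae_iff.1 (hF.ae_differentiableAt (μ := μ))
  set B : ℕ → Set E := fun k ↦ {x ∈ A | DifferentiableAt ℝ F x ∧
    (fderiv ℝ F x + s k • fderiv ℝ P x).det ≠ 0} with hB
  have hcov : A ⊆ N ∪ ⋃ k, B k := by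
    intro x hx
    by_cases hxN : DifferentiableAt ℝ F x
    · refine Or.inr ?_
      by_contra hcon
      simp only [mem_iUnion, not_exists] at hcon
      obtain ⟨Q, -, hQ, hQe⟩ := exists_polynomial_det_add_smul (fderiv ℝ F x) (fderiv ℝ P x)
      have hQ0 : Q = 0 := by
        refine Polynomial.eq_zero_of_infinite_isRoot Q
          ((infinite_range_of_injective hsinj).mono ?_)
        rintro _ ⟨k, rfl⟩
        change Q.eval (s k) = 0
        rw [hQe]
        by_contra h
        exact hcon k ⟨hx, hxN, h⟩
      rw [hQ0, Polynomial.coeff_zero] at hQ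
      exact hdet x hx hQ.symm
    · exact Or.inl hxN
  obtain ⟨k, hk⟩ : ∃ k, μ (B k) ≠ 0 := by
    by_contra! hcon
    exact hA.ne' (measure_mono_null hcov (measure_union_null hN0 (measure_iUnion_null hcon)))
  refine ⟨s k, hspos k, div_le_self hs₀.le (by norm_cast; omega), pos_iff_ne_zero.2 fun h0 ↦ hk ?_⟩
  have hder : ∀ x ∈ B k, HasFDerivAt (fun x ↦ F x + s k • P x)
      (fderiv ℝ F x + s k • fderiv ℝ P x) x := fun x hx ↦
    hx.2.1.hasFDerivAt.add ((hdiff x hx.1).hasFDerivAt.const_smul (s k))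
  refine measure_eq_zero_of_image_null μ (f := fun x ↦ F x + s k • P x)
    (hF.continuous.add (hP.continuous.const_smul (s k)))
    (fun x hx ↦ (hder x hx).differentiableAt) (fun x hx ↦ ?_)
    (measure_mono_null (image_mono fun x hx ↦ hx.1) h0)
  rw [(hder x hx).fderiv]
  exact hx.2.2

theorem pos_of_image_pos {X Y : Type*} [MetricSpace X] [MeasurableSpace X]
    [BorelSpace X] [MetricSpace Y] [MeasurableSpace Y] [BorelSpace Y] {n : ℕ} {s : Set X}
    {t : Set Y} {f : X → Y} {K : ℝ≥0} (hf : LipschitzWith K f) (hts : t ⊆ f '' s)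
    (ht : 0 < μH[(n : ℝ)] t) : 0 < μH[(n : ℝ)] s := by
  refine pos_iff_ne_zero.2 fun h0 ↦ ht.ne' (measure_mono_null hts ?_)
  have := hf.hausdorffMeasure_image_le (d := n) (by positivity) s
  rw [h0, mul_zero] at this
  exact le_antisymm this zero_le

theorem isOpen_setOf_image_pos {X : Type*} [MetricSpace X] [MeasurableSpace X] [BorelSpace X]
    {n : ℕ} {S : Set X} (hrect : IsRectifiable n S)
    (V : Type*) [NormedAddCommGroup V] [MeasurableSpace V] [BorelSpace V] (L : ℝ≥0) :
    IsOpen {f : LipSpace X V L | 0 < μH[(n : ℝ)] (⇑f.1 '' S)} := by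
  have hHaar := isAddHaarMeasure_hausdorffMeasure_euclideanSpace n
  refine Metric.isOpen_iff.2 fun f hf ↦ ?_
  obtain ⟨A, u, K, hu, huS, hpos⟩ := hrect.exists_image_pos f.2 hf
  obtain ⟨p, P, A', ⟨Cp, hp⟩, -, -, hA'A, hPp, hA', hdiff, hdet⟩ :=
    exists_lipschitz_chart (f.2.comp_lipschitzOnWith hu) hpos
  obtain ⟨η, hη, H⟩ := exists_image_pos_of_near μH[(n : ℝ)] hA' hdiff hdet (Cp * (L * K))
  refine ⟨η / (Cp + 1), by positivity, fun g hg ↦ ?_⟩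
  have hpos' := H (fun x ↦ p (g.1 (u x)))
    (hp.comp_lipschitzOnWith (g.2.comp_lipschitzOnWith (hu.mono hA'A))) fun x hx ↦ by
      rw [hPp x hx, ← dist_eq_norm]
      refine (hp.dist_le_mul _ _).trans ?_
      have h1 : dist (g.1 (u x)) (f.1 (u x)) ≤ η / (Cp + 1) :=
        (BoundedContinuousFunction.dist_coe_le_dist (u x)).trans (mem_ball.1 hg).le
      have h2 : (Cp : ℝ) * (η / (Cp + 1)) ≤ η := by
        rw [mul_div_assoc', div_le_iff₀ (by positivity)]
        nlinarith
      exact (mul_le_mul_of_nonneg_left h1 Cp.2).trans h2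
  refine pos_of_image_pos hp ?_ hpos'
  rintro _ ⟨x, hx, rfl⟩
  exact ⟨_, ⟨u x, huS ⟨x, hA'A hx, rfl⟩, rfl⟩, rfl⟩

theorem dense_setOf_image_pos {X : Type*} [MetricSpace X] [MeasurableSpace X] [BorelSpace X]
    {n : ℕ} {S : Set X} (hrect : IsRectifiable n S) (hpos : 0 < μH[(n : ℝ)] S)
    (V : Type*) [NormedAddCommGroup V] [NormedSpace ℝ V] [FiniteDimensional ℝ V]
    [MeasurableSpace V] [BorelSpace V] (hdim : n ≤ Module.finrank ℝ V)
    {L : ℝ≥0} (hL : 0 < L) :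
    Dense {f : LipSpace X V L | 0 < μH[(n : ℝ)] (⇑f.1 '' S)} := by
  have hHaar := isAddHaarMeasure_hausdorffMeasure_euclideanSpace n
  refine Metric.dense_iff.2 fun f r hr ↦ ?_
  obtain ⟨A, u, K, hu, huS, hupos⟩ :=
    hrect.exists_image_pos LipschitzWith.id (by rwa [image_id])
  rw [Function.id_comp] at hupos
  obtain ⟨p, P, A', ⟨Cp, hp⟩, ⟨M, hM⟩, ⟨CP, hP⟩, hA'A, hPp, hA', hdiff, hdet⟩ :=
    exists_lipschitz_chart hu hupos
  obtain ⟨ι₀, hι₀⟩ := (finrank_le_iff_exists_linearMap (R := ℝ)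
    (M := EuclideanSpace ℝ (Fin n)) (M' := V)).1 (by rwa [finrank_euclideanSpace_fin])
  obtain ⟨π₀, hπ₀⟩ := ι₀.exists_leftInverse_of_injective (LinearMap.ker_eq_bot.2 hι₀)
  set ι : EuclideanSpace ℝ (Fin n) →L[ℝ] V := LinearMap.toContinuousLinearMap ι₀ with hι
  set π : V →L[ℝ] EuclideanSpace ℝ (Fin n) := LinearMap.toContinuousLinearMap π₀ with hπ
  have hπι : ∀ x, π (ι x) = x := fun x ↦ LinearMap.congr_fun hπ₀ x
  set δ : ℝ := min 1 (r / (4 * (‖f.1‖ + 1))) with hδ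
  have hδ0 : 0 < δ := by positivity
  have hδ1 : δ ≤ 1 := min_le_left _ _
  have hδf : δ * ‖f.1‖ ≤ r / 4 := by
    have h1 : δ ≤ r / (4 * (‖f.1‖ + 1)) := min_le_right _ _
    rw [le_div_iff₀ (by positivity)] at h1
    nlinarith
  set s₀ : ℝ := min (δ * L / (‖ι‖ * Cp + 1)) (r / (4 * (‖ι‖ * |M| + 1))) with hs₀
  have hLpos : (0 : ℝ) < L := hL
  have hs₀pos : 0 < s₀ := by positivity
  have hfu : LipschitzOnWith (‖π‖₊ * (‖1 - δ‖₊ * (L * K)))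
      (fun x ↦ π ((1 - δ) • f.1 (u x))) A := by
    refine π.lipschitz.comp_lipschitzOnWith ?_
    exact (lipschitzWith_smul (1 - δ)).comp_lipschitzOnWith (f.2.comp_lipschitzOnWith hu)
  obtain ⟨F, hF, hFeq⟩ := hfu.extend_finite_dimension
  obtain ⟨s, hs, hss₀, hspos⟩ :=
    exists_image_add_smul_pos μH[(n : ℝ)] hA' hF hP hdiff hdet hs₀pos
  have hs1 : s * (‖ι‖ * Cp) ≤ δ * L := by
    have h1 : s ≤ δ * L / (‖ι‖ * Cp + 1) := hss₀.trans (min_le_left _ _)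
    rw [le_div_iff₀ (by positivity)] at h1
    nlinarith
  have hs2 : s * (‖ι‖ * |M|) ≤ r / 4 := by
    have h1 : s ≤ r / (4 * (‖ι‖ * |M| + 1)) := hss₀.trans (min_le_right _ _)
    rw [le_div_iff₀ (by positivity)] at h1
    nlinarith
  have hιp : ∀ x, ‖s • ι (p x)‖ ≤ r / 4 := by
    intro x
    rw [norm_smul, Real.norm_eq_abs, abs_of_pos hs]
    refine le_trans (mul_le_mul_of_nonneg_left ((ι.le_opNorm _).trans
      (mul_le_mul_of_nonneg_left ((hM x).trans (le_abs_self M)) (norm_nonneg _))) hs.le) hs2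
  set G : X → V := fun x ↦ (1 - δ) • f.1 x + s • ι (p x) with hG
  have hGlip : LipschitzWith L G := by
    refine LipschitzWith.of_dist_le_mul fun x y ↦ ?_
    have h1 : dist ((1 - δ) • f.1 x) ((1 - δ) • f.1 y) ≤ (1 - δ) * (L * dist x y) := by
      rw [dist_smul₀, Real.norm_eq_abs, abs_of_nonneg (by linarith)]
      exact mul_le_mul_of_nonneg_left (f.2.dist_le_mul x y) (by linarith)
    have h2 : dist (s • ι (p x)) (s • ι (p y)) ≤ s * (‖ι‖ * (Cp * dist x y)) := by
      rw [dist_smul₀, Real.norm_eq_abs, abs_of_pos hs]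
      refine mul_le_mul_of_nonneg_left ((ι.lipschitz.dist_le_mul _ _).trans ?_) hs.le
      exact mul_le_mul_of_nonneg_left (hp.dist_le_mul x y) (norm_nonneg _)
    have h3 := mul_le_mul_of_nonneg_right hs1 (dist_nonneg (x := x) (y := y))
    refine (dist_add_add_le _ _ _ _).trans ((add_le_add h1 h2).trans ?_)
    linarith
  have hGf : ∀ x, dist (G x) (f.1 x) ≤ r / 2 := by
    intro x
    have h1 : G x - f.1 x = s • ι (p x) - δ • f.1 x := by
      simp only [hG]; module
    have h2 : ‖δ • f.1 x‖ ≤ r / 4 := by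
      rw [norm_smul, Real.norm_eq_abs, abs_of_pos hδ0]
      exact (mul_le_mul_of_nonneg_left (f.1.norm_coe_le_norm x) hδ0.le).trans hδf
    rw [dist_eq_norm, h1]
    refine (norm_sub_le _ _).trans ?_
    linarith [hιp x]
  have hGb : ∀ x, ‖G x‖ ≤ ‖f.1‖ + r / 2 := by
    intro x
    have h1 := norm_le_norm_add_norm_sub' (G x) (f.1 x)
    rw [← dist_eq_norm] at h1
    linarith [hGf x, f.1.norm_coe_le_norm x]
  refine ⟨⟨BoundedContinuousFunction.ofNormedAddCommGroup G hGlip.continuous _ hGb, hGlip⟩, ?_, ?_⟩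
  · refine mem_ball.2 (lt_of_le_of_lt ?_ (half_lt_self hr))
    exact (BoundedContinuousFunction.dist_le (by positivity)).2 hGf
  · refine pos_of_image_pos π.lipschitz ?_ hspos
    rintro _ ⟨x, hx, rfl⟩
    refine ⟨_, ⟨u x, huS ⟨x, hA'A hx, rfl⟩, rfl⟩, ?_⟩
    change π ((1 - δ) • f.1 (u x) + s • ι (p (u x))) = F x + s • P x
    rw [map_add, map_smul π s, hπι, ← hFeq (hA'A hx), hPp x hx]

theorem stmt6 {X : Type*} [MetricSpace X] [CompleteSpace X] [MeasurableSpace X] [BorelSpace X]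
    (n : ℕ) (hn : 1 ≤ n) (S : Set X)
    (hrect : IsRectifiable n S) (hpos : 0 < μH[(n : ℝ)] S)
    (V : Type*) [NormedAddCommGroup V] [NormedSpace ℝ V] [FiniteDimensional ℝ V]
    [MeasurableSpace V] [BorelSpace V] (hdim : n ≤ Module.finrank ℝ V)
    (L : ℝ≥0) (hL : 0 < L) :
    IsOpen {f : LipSpace X V L | 0 < μH[(n : ℝ)] (⇑f.1 '' S)} ∧
      Dense {f : LipSpace X V L | 0 < μH[(n : ℝ)] (⇑f.1 '' S)} := by
  exact ⟨isOpen_setOf_image_pos hrect V L, dense_setOf_image_pos hrect hpos V hdim hL⟩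
end
end

section
/- Let X be a complete metric space, n ≥ 1 an integer, and S ⊆ X an n-rectifiable set with H^n(S) > 0. Then there exists c > 0 such that for every L ≥ 1 there exists ε₀ > 0 with the following property: for every 0 < ε ≤ ε₀, every metric space (Y,ρ) and every L-Lipschitz map σ : X → Y satisfying |d(x,y) − ρ(σ(x),σ(y))| < ε for all x, y ∈ S, one has H^n(σ(S)) ≥ c. -/
open MeasureTheory Metric Set Filter
open scoped NNReal ENNReal Topology

noncomputable section

lemma LipschitzWith.hausdorffMeasure_image_eq_zero {X Y : Type*} [EMetricSpace X] [EMetricSpace Y]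
    [MeasurableSpace X] [BorelSpace X] [MeasurableSpace Y] [BorelSpace Y] {F : X → Y} {C : ℝ≥0}
    (hF : LipschitzWith C F) {d : ℝ} (hd : 0 ≤ d) {s : Set X} (hs : μH[d] s = 0) :
    μH[d] (F '' s) = 0 := by
  have := hF.hausdorffMeasure_image_le hd s
  rw [hs, mul_zero] at this
  exact le_antisymm this bot_le

section Degree

variable {E : Type*} [NormedAddCommGroup E] [InnerProductSpace ℝ E] [FiniteDimensional ℝ E]

/-- The determinant of `1 + s • A` is a polynomial in `s`, hence given by Lagrange interpolation. -/
lemma det_one_add_smul_eq_sum_lagrange (A : E →L[ℝ] E)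
    {τ : Fin (Module.finrank ℝ E + 1) → ℝ} (hτ : Function.Injective τ) (s : ℝ) :
    (1 + s • A).det = ∑ j, (Lagrange.basis Finset.univ τ j).eval s * (1 + τ j • A).det := by
  classical
  let b := Module.finBasis ℝ E
  let M := LinearMap.toMatrix b b (A : E →ₗ[ℝ] E)
  let P : Polynomial ℝ :=
    ((1 : Matrix (Fin (Module.finrank ℝ E)) (Fin (Module.finrank ℝ E)) (Polynomial ℝ)) +
      (Polynomial.X : Polynomial ℝ) • M.map Polynomial.C).det
  have hP : ∀ t : ℝ, P.eval t = (1 + t • A).det := by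
    intro t
    have h1 : (1 + t • A).det = (1 + t • M).det := by
      rw [ContinuousLinearMap.det, ← LinearMap.det_toMatrix b]
      congr 1
      simp [M, LinearMap.toMatrix_one]
    rw [h1, ← Polynomial.coe_evalRingHom, RingHom.map_det]
    congr 1
    ext i j
    by_cases hij : i = j <;> simp [hij, mul_comm t]
  have hdeg : P.degree < (Finset.univ : Finset (Fin (Module.finrank ℝ E + 1))).card := by
    have h := Polynomial.natDegree_det_X_add_C_le M 1
    have h2 : P.natDegree ≤ Module.finrank ℝ E := by
      have e : P = ((Polynomial.X : Polynomial ℝ) • M.map Polynomial.C +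
          (1 : Matrix _ _ ℝ).map Polynomial.C).det := by
        simp only [P]
        rw [add_comm]
        congr 2
        ext i j
        by_cases hij : i = j <;> simp [Matrix.one_apply, hij]
      rw [e]
      simpa using h
    calc P.degree ≤ P.natDegree := Polynomial.degree_le_natDegree
      _ < _ := by
        simp only [Finset.card_univ, Fintype.card_fin]
        exact_mod_cast Nat.lt_succ_of_le h2
  have hint := Lagrange.eq_interpolate_of_eval_eq (s := Finset.univ) (v := τ)
    (fun j => (1 + τ j • A).det) (hτ.injOn) hdeg (fun j _ => hP _)
  rw [← hP, hint, Lagrange.interpolate_apply, Polynomial.eval_finsetSum]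
  simp [mul_comm]

lemma det_one_add_pos {B : E →L[ℝ] E} (hB : ‖B‖ < 1) : 0 < (1 + B).det := by
  have hne : ∀ t ∈ Icc (0 : ℝ) 1, (1 + t • B).det ≠ 0 := by
    intro t ht h0
    have hker : ∃ x : E, x ≠ 0 ∧ (1 + t • B) x = 0 := by
      have := LinearMap.bot_lt_ker_of_det_eq_zero (f := ((1 + t • B : E →L[ℝ] E) : E →ₗ[ℝ] E)) h0
      obtain ⟨x, hx, hx0⟩ := Submodule.exists_mem_ne_zero_of_ne_bot this.ne'
      exact ⟨x, hx0, hx⟩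
    obtain ⟨x, hx0, hx⟩ := hker
    have h1 : x = - (t • B x) := by
      have : x + t • B x = 0 := by simpa using hx
      exact eq_neg_of_add_eq_zero_left this
    have h2 : ‖x‖ ≤ ‖B‖ * ‖x‖ := by
      calc ‖x‖ = ‖t • B x‖ := by conv_lhs => rw [h1, norm_neg]
        _ = t * ‖B x‖ := by rw [norm_smul, Real.norm_of_nonneg ht.1]
        _ ≤ 1 * ‖B x‖ := by gcongr; exact ht.2
        _ ≤ ‖B‖ * ‖x‖ := by rw [one_mul]; exact B.le_opNorm x
    have h3 : 0 < ‖x‖ := norm_pos_iff.2 hx0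
    nlinarith
  by_contra! hle
  have hcont : ContinuousOn (fun t : ℝ => (1 + t • B).det) (Icc 0 1) := by
    apply Continuous.continuousOn
    exact ContinuousLinearMap.continuous_det.comp (by fun_prop)
  have h := intermediate_value_Icc' (zero_le_one' ℝ) hcont
  have h0 : (0 : ℝ) ∈ Icc ((1 + (1 : ℝ) • B).det) ((1 + (0 : ℝ) • B).det) := by
    refine ⟨by simpa using hle, ?_⟩
    simp [ContinuousLinearMap.det]
  obtain ⟨t, ht, ht0⟩ := h h0
  exact hne t ht ht0

lemma bijective_add_smul_of_lipschitzWith {u : E → E} {M : ℝ≥0} (hu : LipschitzWith M u) {t : ℝ≥0}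
    (ht : t * M < 1) : Function.Bijective (fun x => x + (t : ℝ) • u x) := by
  have hl : LipschitzWith (t * M) (fun x => (t : ℝ) • u x) := by
    apply LipschitzWith.of_dist_le_mul
    intro x y
    rw [dist_smul₀, Real.norm_of_nonneg t.coe_nonneg, NNReal.coe_mul, mul_assoc]
    gcongr
    exact hu.dist_le_mul x y
  constructor
  · intro x y hxy
    by_contra hne
    have h1 : dist x y = dist ((t : ℝ) • u x) ((t : ℝ) • u y) := by
      rw [dist_eq_norm, dist_eq_norm, ← norm_neg]
      congr 1
      have : x + (t : ℝ) • u x = y + (t : ℝ) • u y := hxy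
      rw [neg_sub]
      rw [sub_eq_sub_iff_add_eq_add, ← this, add_comm]
    have h2 := hl.dist_le_mul x y
    have h3 : 0 < dist x y := dist_pos.2 hne
    have h4 : ((t * M : ℝ≥0) : ℝ) < 1 := by exact_mod_cast ht
    rw [← h1] at h2
    nlinarith
  · intro y
    have hc : ContractingWith (t * M) (fun x => y - (t : ℝ) • u x) :=
      ⟨ht, by
        apply LipschitzWith.of_dist_le_mul
        intro a b
        rw [dist_sub_left]
        exact hl.dist_le_mul a b⟩
    refine ⟨hc.fixedPoint, ?_⟩
    have := hc.fixedPoint_isFixedPt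
    have h2 : y - (t : ℝ) • u hc.fixedPoint = hc.fixedPoint := this
    change hc.fixedPoint + (t : ℝ) • u hc.fixedPoint = y
    exact (sub_eq_iff_eq_add.1 h2).symm

variable [MeasurableSpace E] [BorelSpace E]

lemma lintegral_det_one_add_smul_fderiv {u : E → E} {M : ℝ≥0} (hu : LipschitzWith M u) {R : ℝ}
    (hR : ∀ x, x ∉ ball (0 : E) R → u x = 0) {t : ℝ≥0} (ht : t * M < 1) :
    ∫⁻ x in ball (0 : E) R, ENNReal.ofReal (1 + (t : ℝ) • fderiv ℝ u x).det
      ∂μH[Module.finrank ℝ E] = μH[Module.finrank ℝ E] (ball (0 : E) R) := by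
  set μ : Measure E := μH[Module.finrank ℝ E]
  set F : E → E := fun x => x + (t : ℝ) • u x with hFdef
  have hbij : Function.Bijective F := bijective_add_smul_of_lipschitzWith hu ht
  have hFout : ∀ x, x ∉ ball (0 : E) R → F x = x := fun x hx => by simp [F, hR x hx]
  have himage : F '' ball 0 R = ball 0 R := by
    have h1 : F '' (ball 0 R)ᶜ = (ball 0 R)ᶜ := by
      ext y
      constructor
      · rintro ⟨x, hx, rfl⟩
        rwa [hFout x hx]
      · intro hy
        exact ⟨y, hy, hFout y hy⟩
    have h2 := image_compl_eq hbij (s := ball (0 : E) R)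
    rw [h1] at h2
    exact (compl_injective h2).symm
  have hFl : LipschitzWith (1 + t * M) F := by
    apply LipschitzWith.id.add
    apply LipschitzWith.of_dist_le_mul
    intro x y
    rw [dist_smul₀, Real.norm_of_nonneg t.coe_nonneg, NNReal.coe_mul, mul_assoc]
    gcongr
    exact hu.dist_le_mul x y
  set D : Set E := {x | DifferentiableAt ℝ u x}
  have hD : MeasurableSet D := measurableSet_of_differentiableAt ℝ u
  have hDnull : μ (ball (0 : E) R \ D) = 0 := by
    refine measure_mono_null (fun x hx => hx.2) (hu.ae_differentiableAt (μ := μ))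
  have hs : MeasurableSet (ball (0 : E) R ∩ D) := measurableSet_ball.inter hD
  have hae : (ball (0 : E) R ∩ D : Set E) =ᵐ[μ] ball (0 : E) R := by
    rw [← sdiff_sdiff_right_self]
    refine sdiff_null_ae_eq_self hDnull
  have key := lintegral_abs_det_fderiv_eq_addHaar_image μ hs
    (f := F) (f' := fun x => 1 + (t : ℝ) • fderiv ℝ u x)
    (fun x hx => by
      have h : HasFDerivAt u (fderiv ℝ u x) x := hx.2.hasFDerivAt
      exact ((hasFDerivAt_id x).add (h.const_smul (t : ℝ))).hasFDerivWithinAt)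
    hbij.1.injOn
  have himg : μ (F '' (ball (0 : E) R ∩ D)) = μ (ball (0 : E) R) := by
    apply le_antisymm
    · conv_rhs => rw [← himage]
      exact measure_mono (image_mono inter_subset_left)
    · conv_lhs => rw [← himage, ← inter_union_sdiff (ball (0 : E) R) D, image_union]
      refine (measure_union_le _ _).trans ?_
      rw [hFl.hausdorffMeasure_image_eq_zero (by positivity) hDnull, add_zero]
  rw [himg, Measure.restrict_congr_set hae] at key
  rw [← key]
  refine lintegral_congr fun x => ?_
  rw [abs_of_pos]
  apply det_one_add_pos
  rw [norm_smul, Real.norm_of_nonneg t.coe_nonneg]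
  calc (t : ℝ) * ‖fderiv ℝ u x‖ ≤ t * M := by
        gcongr
        exact norm_fderiv_le_of_lipschitz ℝ hu
    _ < 1 := by exact_mod_cast ht

/-- The integral of the Jacobian of a Lipschitz map only depends on its boundary values. -/
lemma integral_det_one_add_fderiv {u : E → E} {M : ℝ≥0} (hu : LipschitzWith M u) {R : ℝ}
    (hR : ∀ x, x ∉ ball (0 : E) R → u x = 0) :
    ∫ x in ball (0 : E) R, (1 + fderiv ℝ u x).det ∂μH[Module.finrank ℝ E] =
      μH[Module.finrank ℝ E].real (ball (0 : E) R) := by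
  set μ : Measure E := μH[Module.finrank ℝ E]
  set d := Module.finrank ℝ E
  let t : Fin (d + 1) → ℝ≥0 := fun j => ((j : ℕ) : ℝ≥0) / ((d + 1) * (M + 1))
  have hden : (0 : ℝ≥0) < (d + 1) * (M + 1) := by positivity
  have ht : ∀ j, t j * M < 1 := by
    intro j
    have hj : ((j : ℕ) : ℝ≥0) < d + 1 := by exact_mod_cast j.2
    have : t j * M = (((j : ℕ) : ℝ≥0) * M) / ((d + 1) * (M + 1)) := by
      simp only [t]; ring
    rw [this, div_lt_one hden]
    calc ((j : ℕ) : ℝ≥0) * M ≤ (d + 1) * M := by gcongr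
      _ < (d + 1) * (M + 1) := by
        gcongr
        exact lt_add_one M
  have hinj : Function.Injective (fun j => (t j : ℝ)) := by
    intro i j hij
    have h1 : t i = t j := NNReal.coe_injective hij
    simp only [t] at h1
    rw [div_left_inj' hden.ne'] at h1
    exact Fin.ext (by exact_mod_cast h1)
  have hpos : ∀ j x, 0 ≤ (1 + (t j : ℝ) • fderiv ℝ u x).det := by
    intro j x
    apply (det_one_add_pos _).le
    rw [norm_smul, Real.norm_of_nonneg (t j).coe_nonneg]
    calc (t j : ℝ) * ‖fderiv ℝ u x‖ ≤ t j * M := by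
          gcongr
          exact norm_fderiv_le_of_lipschitz ℝ hu
      _ < 1 := by exact_mod_cast ht j
  have hmeas : ∀ j, AEStronglyMeasurable (fun x => (1 + (t j : ℝ) • fderiv ℝ u x).det)
      (μ.restrict (ball 0 R)) := by
    intro j
    have h2 : Continuous (fun A : E →L[ℝ] E => (1 + (t j : ℝ) • A).det) :=
      ContinuousLinearMap.continuous_det.comp (by fun_prop)
    exact (h2.measurable.comp (measurable_fderiv ℝ u)).aestronglyMeasurable
  have hfin : μ (ball (0 : E) R) ≠ ⊤ := measure_ball_lt_top.ne
  have hintg : ∀ j, Integrable (fun x => (1 + (t j : ℝ) • fderiv ℝ u x).det)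
      (μ.restrict (ball 0 R)) := by
    intro j
    refine ⟨hmeas j, ?_⟩
    rw [hasFiniteIntegral_iff_ofReal (Eventually.of_forall (hpos j)),
      lintegral_det_one_add_smul_fderiv hu hR (ht j)]
    exact hfin.lt_top
  have hval : ∀ j, ∫ x in ball (0 : E) R, (1 + (t j : ℝ) • fderiv ℝ u x).det ∂μ =
      μ.real (ball (0 : E) R) := by
    intro j
    rw [integral_eq_lintegral_of_nonneg_ae (Eventually.of_forall (hpos j)) (hmeas j),
      lintegral_det_one_add_smul_fderiv hu hR (ht j)]
    rfl
  have hL : ∀ x, (1 + fderiv ℝ u x).det = ∑ j,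
      (Lagrange.basis Finset.univ (fun j => (t j : ℝ)) j).eval 1 *
        (1 + (t j : ℝ) • fderiv ℝ u x).det := by
    intro x
    have := det_one_add_smul_eq_sum_lagrange (fderiv ℝ u x) hinj 1
    rwa [one_smul] at this
  simp_rw [hL]
  rw [integral_finsetSum _ (fun j _ => (hintg j).const_mul _)]
  simp_rw [integral_const_mul, hval]
  rw [← Finset.sum_mul, ← Polynomial.eval_finsetSum,
    Lagrange.sum_basis hinj.injOn Finset.univ_nonempty]
  simp

/-- A Lipschitz map that fixes all points outside a ball of radius `R` and never vanishes cannot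
map this ball to a sphere. -/
lemma not_norm_eq_const_of_eq_id_off_ball {G : E → E} {C : ℝ≥0} (hG : LipschitzWith C G) {R : ℝ}
    (hR : 0 < R) (hid : ∀ x, x ∉ ball (0 : E) R → G x = x)
    (hsph : ∀ x ∈ ball (0 : E) R, ‖G x‖ = R) : False := by
  set μ : Measure E := μH[Module.finrank ℝ E]
  have hu : LipschitzWith (C + 1) (fun x => G x - x) := hG.sub LipschitzWith.id
  have h := integral_det_one_add_fderiv hu (R := R) (fun x hx => by simp [hid x hx])
  have h0 : ∫ x in ball (0 : E) R, (1 + fderiv ℝ (fun x => G x - x) x).det ∂μ = 0 := by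
    apply integral_eq_zero_of_ae
    have hd := ae_restrict_of_ae (s := ball (0 : E) R) (hG.ae_differentiableAt (μ := μ))
    filter_upwards [hd, ae_restrict_mem measurableSet_ball] with x hx hxR
    have e : 1 + fderiv ℝ (fun x => G x - x) x = fderiv ℝ G x := by
      rw [fderiv_fun_sub hx differentiableAt_fun_id]
      ext v
      simp
    rw [e]
    by_contra hne
    have hsurj : Function.Surjective (fderiv ℝ G x) := by
      have := (LinearMap.equivOfDetNeZero (fderiv ℝ G x : E →ₗ[ℝ] E) hne).surjective
      exact this
    obtain ⟨v, hv⟩ := hsurj (G x)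
    have hder : HasFDerivAt (fun y => ‖G y‖ ^ 2) (2 • (innerSL ℝ (G x)).comp (fderiv ℝ G x)) x :=
      hx.hasFDerivAt.norm_sq
    have hconst : (fun y => ‖G y‖ ^ 2) =ᶠ[𝓝 x] fun _ => R ^ 2 := by
      filter_upwards [isOpen_ball.mem_nhds hxR] with y hy
      rw [hsph y hy]
    have hz := hder.unique ((hasFDerivAt_const (R ^ 2) x).congr_of_eventuallyEq hconst)
    have hz2 := congrArg (fun T => T v) hz
    simp [hv] at hz2
    have := hsph x hxR
    rw [hz2, norm_zero] at this
    exact hR.ne this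
  rw [h0] at h
  have hp : 0 < μ (ball (0 : E) R) := measure_ball_pos μ 0 hR
  have hfin : μ (ball (0 : E) R) ≠ ⊤ := measure_ball_lt_top.ne
  exact (ENNReal.toReal_pos hp.ne' hfin).ne h

end Degree

section Surjective

lemma dist_max_div_norm_smul_le {E : Type*} [NormedAddCommGroup E] [NormedSpace ℝ E]
    {r s : ℝ} (hr : 0 ≤ r) (hs : 0 < s) {y z : E} (hy : s ≤ ‖y‖)
    (hz : s ≤ ‖z‖) :
    dist (max (r / ‖y‖) 1 • y) (max (r / ‖z‖) 1 • z) ≤ (1 + 2 * (r / s)) * dist y z := by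
  have hy0 : 0 < ‖y‖ := hs.trans_le hy
  have hz0 : 0 < ‖z‖ := hs.trans_le hz
  have e : max (r / ‖y‖) 1 • y - max (r / ‖z‖) 1 • z =
      max (r / ‖y‖) 1 • (y - z) + (max (r / ‖y‖) 1 - max (r / ‖z‖) 1) • z := by
    module
  have h1 : max (r / ‖y‖) 1 ≤ 1 + r / s := by
    have : r / ‖y‖ ≤ r / s := by gcongr
    have : 0 ≤ r / s := by positivity
    apply max_le <;> linarith
  have h2 : |max (r / ‖y‖) 1 - max (r / ‖z‖) 1| * ‖z‖ ≤ r / s * ‖y - z‖ := by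
    have h3 : |r / ‖y‖ - r / ‖z‖| = r * |‖z‖ - ‖y‖| / (‖y‖ * ‖z‖) := by
      rw [div_sub_div _ _ hy0.ne' hz0.ne', abs_div, abs_of_pos (mul_pos hy0 hz0),
        mul_comm ‖y‖ r, ← mul_sub, abs_mul, abs_of_nonneg hr]
    calc |max (r / ‖y‖) 1 - max (r / ‖z‖) 1| * ‖z‖ ≤ |r / ‖y‖ - r / ‖z‖| * ‖z‖ := by
          exact mul_le_mul_of_nonneg_right
            (abs_max_sub_max_le_abs (r / ‖y‖) (r / ‖z‖) 1) (norm_nonneg z)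
      _ = r / ‖y‖ * |‖z‖ - ‖y‖| := by rw [h3]; field_simp
      _ ≤ r / s * ‖y - z‖ := by
          gcongr
          rw [norm_sub_rev y z]
          exact abs_norm_sub_norm_le z y
  rw [dist_eq_norm, dist_eq_norm, e]
  calc _ ≤ ‖max (r / ‖y‖) 1 • (y - z)‖ + ‖(max (r / ‖y‖) 1 - max (r / ‖z‖) 1) • z‖ :=
        norm_add_le _ _
    _ = max (r / ‖y‖) 1 * ‖y - z‖ + |max (r / ‖y‖) 1 - max (r / ‖z‖) 1| * ‖z‖ := by
        rw [norm_smul, norm_smul, Real.norm_of_nonneg (by positivity), Real.norm_eq_abs]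
    _ ≤ (1 + r / s) * ‖y - z‖ + r / s * ‖y - z‖ := by gcongr
    _ = _ := by ring

variable {E : Type*} [NormedAddCommGroup E] [InnerProductSpace ℝ E] [FiniteDimensional ℝ E]
  [MeasurableSpace E] [BorelSpace E]

lemma exists_eq_zero_of_eq_id_off_ball {H : E → E} {C : ℝ≥0} (hH : LipschitzWith C H) {R : ℝ}
    (hR : 0 ≤ R) (hid : ∀ x, x ∉ ball (0 : E) R → H x = x) : ∃ x, H x = 0 := by
  by_contra! hne
  set r : ℝ := C * R + ‖H 0‖ + R + 1 with hr
  have hr0 : 0 < r := by positivity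
  have hRr : R ≤ r := by
    have : 0 ≤ C * R + ‖H 0‖ := by positivity
    linarith
  have hid' : ∀ x, x ∉ ball (0 : E) r → H x = x :=
    fun x hx => hid x fun h => hx (ball_subset_ball hRr h)
  have hle : ∀ x ∈ ball (0 : E) r, ‖H x‖ ≤ r := by
    intro x hx
    by_cases hxR : x ∈ ball (0 : E) R
    · have h1 := hH.dist_le_mul x 0
      have h2 : dist x 0 ≤ R := (mem_ball.1 hxR).le
      have h3 : ‖H x‖ ≤ ‖H 0‖ + dist (H x) (H 0) := by
        rw [dist_eq_norm]
        calc ‖H x‖ = ‖H 0 + (H x - H 0)‖ := by congr 1; abel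
          _ ≤ _ := norm_add_le _ _
      have h4 : (C : ℝ) * dist x 0 ≤ C * R := by gcongr
      linarith
    · rw [hid x hxR]
      exact (mem_ball_zero_iff.1 hx).le
  obtain ⟨s, hs0, hs⟩ : ∃ s : ℝ, 0 < s ∧ ∀ x, s ≤ ‖H x‖ := by
    obtain ⟨x₀, -, hx₀⟩ := (isCompact_closedBall (0 : E) r).exists_isMinOn
      ⟨0, mem_closedBall_self hr0.le⟩ (hH.continuous.norm.continuousOn)
    refine ⟨min r ‖H x₀‖, lt_min hr0 (norm_pos_iff.2 (hne x₀)), fun x => ?_⟩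
    by_cases hx : x ∈ ball (0 : E) r
    · exact (min_le_right _ _).trans (hx₀ (ball_subset_closedBall hx))
    · rw [hid' x hx]
      exact (min_le_left _ _).trans (by simpa using hx)
  refine not_norm_eq_const_of_eq_id_off_ball
    (G := fun x => max (r / ‖H x‖) 1 • H x) (C := (1 + 2 * (r / s)).toNNReal * C) ?_ hr0 ?_ ?_
  · apply LipschitzWith.of_dist_le_mul
    intro x y
    refine (dist_max_div_norm_smul_le hr0.le hs0 (hs x) (hs y)).trans ?_
    rw [NNReal.coe_mul, Real.coe_toNNReal _ (by positivity), mul_assoc]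
    gcongr
    exact hH.dist_le_mul x y
  · intro x hx
    have h1 : r ≤ ‖x‖ := by simpa using hx
    have h2 : r / ‖x‖ ≤ 1 := div_le_one_of_le₀ h1 (norm_nonneg _)
    simp only [hid' x hx, max_eq_right h2, one_smul]
  · intro x hx
    have h1 : 0 < ‖H x‖ := norm_pos_iff.2 (hne x)
    have h2 : 1 ≤ r / ‖H x‖ := (one_le_div h1).2 (hle x hx)
    simp only [max_eq_left h2, norm_smul, norm_div, norm_norm, Real.norm_of_nonneg hr0.le]
    field_simp

/-- A Lipschitz self-map of a Euclidean space that fixes all points outside a bounded set is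
surjective. -/
theorem LipschitzWith.surjective_of_eq_id_off_isBounded {F : E → E} {C : ℝ≥0}
    (hF : LipschitzWith C F) {U : Set E} (hU : Bornology.IsBounded U)
    (hid : ∀ x, x ∉ U → F x = x) : Function.Surjective F := by
  intro p
  obtain ⟨R, hR0, hR⟩ := hU.subset_ball_lt 0 p
  obtain ⟨x, hx⟩ := exists_eq_zero_of_eq_id_off_ball (H := fun x => F (x + p) - p) (C := C)
    (R := R) (by
      apply LipschitzWith.of_dist_le_mul
      intro x y
      rw [dist_sub_right]
      simpa using hF.dist_le_mul (x + p) (y + p)) hR0.le (by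
      intro x hx
      have : x + p ∉ U := by
        intro h
        apply hx
        have := hR h
        simpa [dist_eq_norm] using this
      simp [hid _ this])
  exact ⟨x + p, sub_eq_zero.1 hx⟩

/-- A Lipschitz map that is close to the identity on a set `K`, filling most of an open set `U`,
has an image which is not much smaller than `U`. -/
theorem hausdorffMeasure_le_image_add_of_dist_le {K U : Set E} (hU : Bornology.IsBounded U)
    (hKU : K ⊆ U) {F : E → E} {C : ℝ≥0} (hF : LipschitzOnWith C F K) {τ : ℝ}
    (hτ : ∀ x ∈ K, ∀ y ∉ U, τ ≤ dist x y) (hdist : ∀ x ∈ K, dist (F x) x ≤ τ) :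
    μH[Module.finrank ℝ E] U ≤ μH[Module.finrank ℝ E] (F '' K) +
      ((lipschitzExtensionConstant E * max C 2 : ℝ≥0) : ℝ≥0∞) ^ (Module.finrank ℝ E) *
        μH[Module.finrank ℝ E] (U \ K) := by
  classical
  set F₁ : E → E := fun x => if x ∈ K then F x else x with hF₁
  have hK1 : ∀ x ∈ K, F₁ x = F x := fun x hx => if_pos hx
  have hU1 : ∀ x ∈ Uᶜ, F₁ x = x := fun x hx => if_neg fun h => hx (hKU h)
  have hcross : ∀ x ∈ K, ∀ y ∈ Uᶜ, dist (F₁ x) (F₁ y) ≤ max C 2 * dist x y := by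
    intro x hx y hy
    rw [hK1 x hx, hU1 y hy]
    calc dist (F x) y ≤ dist (F x) x + dist x y := dist_triangle _ _ _
      _ ≤ dist x y + dist x y := by
        gcongr
        exact (hdist x hx).trans (hτ x hx y hy)
      _ = 2 * dist x y := by ring
      _ ≤ _ := by gcongr; exact le_max_right _ _
  have hL : LipschitzOnWith (max C 2) F₁ (K ∪ Uᶜ) := by
    apply LipschitzOnWith.of_dist_le_mul
    rw [NNReal.coe_max, NNReal.coe_ofNat]
    rintro x (hx | hx) y (hy | hy)
    · rw [hK1 x hx, hK1 y hy]
      refine (hF.dist_le_mul x hx y hy).trans ?_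
      gcongr
      exact le_max_left _ _
    · exact hcross x hx y hy
    · rw [dist_comm, dist_comm x y]
      exact hcross y hy x hx
    · rw [hU1 x hx, hU1 y hy]
      have : (1 : ℝ) ≤ max (C : ℝ) 2 := le_max_of_le_right (by norm_num)
      nlinarith [dist_nonneg (x := x) (y := y)]
  obtain ⟨F₂, hF₂, heq⟩ := hL.extend_finite_dimension
  have hsurj : Function.Surjective F₂ := hF₂.surjective_of_eq_id_off_isBounded hU
    fun x hx => by rw [← heq (Or.inr hx), hU1 x hx]
  have hsub : U ⊆ F '' K ∪ F₂ '' (U \ K) := by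
    intro y hy
    obtain ⟨x, rfl⟩ := hsurj y
    by_cases hxU : x ∈ U
    · by_cases hxK : x ∈ K
      · left
        exact ⟨x, hxK, by rw [← heq (Or.inl hxK), hK1 x hxK]⟩
      · exact Or.inr ⟨x, ⟨hxU, hxK⟩, rfl⟩
    · exact absurd (by rwa [← heq (Or.inr hxU), hU1 x hxU] at hy) hxU
  refine (measure_mono hsub).trans ((measure_union_le _ _).trans ?_)
  gcongr
  have := hF₂.hausdorffMeasure_image_le (d := Module.finrank ℝ E) (by positivity) (U \ K)
  rwa [ENNReal.rpow_natCast] at this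

end Surjective

section Stability

lemma EuclideanSpace.dist_le_sqrt_mul {n : ℕ} {x y : EuclideanSpace ℝ (Fin n)} {r : ℝ} (hr : 0 ≤ r)
    (h : ∀ j, dist (x j) (y j) ≤ r) : dist x y ≤ √n * r := by
  rw [EuclideanSpace.dist_eq]
  apply Real.sqrt_le_iff.2
  refine ⟨by positivity, ?_⟩
  calc ∑ j, dist (x j) (y j) ^ 2 ≤ ∑ _j : Fin n, r ^ 2 := by
        gcongr with j
        exact h j
    _ = (√n * r) ^ 2 := by
        rw [mul_pow, Real.sq_sqrt (Nat.cast_nonneg n)]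
        simp

/-- A map `g` with `|x - x'| ≤ k (ρ(g x, g x') + ε)` has a Lipschitz almost inverse. -/
lemma exists_lipschitzWith_dist_le {n : ℕ} {Y : Type*} [MetricSpace Y]
    {K : Set (EuclideanSpace ℝ (Fin n))} (hK : Bornology.IsBounded K)
    {g : EuclideanSpace ℝ (Fin n) → Y} {k : ℝ≥0} {ε : ℝ}
    (hg : ∀ x ∈ K, ∀ x' ∈ K, dist x x' ≤ k * (dist (g x) (g x') + ε)) :
    ∃ h : Y → EuclideanSpace ℝ (Fin n), LipschitzWith (NNReal.sqrt n * k) h ∧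
      ∀ x ∈ K, dist (h (g x)) x ≤ √n * (k * ε) := by
  rcases K.eq_empty_or_nonempty with rfl | hne
  · exact ⟨fun _ => 0, LipschitzWith.const' 0, by simp⟩
  have : Nonempty K := hne.to_subtype
  obtain ⟨B, hB⟩ := hK.exists_norm_le
  have hcoord : ∀ (x y : EuclideanSpace ℝ (Fin n)) j, |x j - y j| ≤ dist x y := by
    intro x y j
    rw [dist_eq_norm]
    simpa using PiLp.norm_apply_le (x - y) j
  let φ : Fin n → Y → K → ℝ := fun j y x => x.1 j + k * dist y (g x)
  have hbdd : ∀ j y, BddBelow (range (φ j y)) := by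
    intro j y
    refine ⟨-B, ?_⟩
    rintro _ ⟨x, rfl⟩
    have h1 : |x.1 j| ≤ B := by
      have := PiLp.norm_apply_le x.1 j
      rw [Real.norm_eq_abs] at this
      exact this.trans (hB x x.2)
    have h2 : 0 ≤ k * dist y (g x) := by positivity
    simp only [φ]
    linarith [neg_abs_le (x.1 j)]
  have hle : ∀ j y y', (⨅ x, φ j y x) ≤ (⨅ x, φ j y' x) + k * dist y y' := by
    intro j y y'
    rw [← sub_le_iff_le_add]
    refine le_ciInf fun x => ?_
    rw [sub_le_iff_le_add]
    refine (ciInf_le (hbdd j y) x).trans ?_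
    have : (k : ℝ) * dist y (g x) ≤ k * (dist y y' + dist y' (g x)) := by
      gcongr
      exact dist_triangle _ _ _
    simp only [φ]
    linarith
  refine ⟨fun y => WithLp.toLp 2 fun j => ⨅ x, φ j y x, ?_, ?_⟩
  · apply LipschitzWith.of_dist_le_mul
    intro y y'
    rw [NNReal.coe_mul, Real.coe_sqrt, NNReal.coe_natCast, mul_assoc]
    refine EuclideanSpace.dist_le_sqrt_mul (by positivity) fun j => ?_
    rw [Real.dist_eq, abs_sub_le_iff]
    constructor
    · linarith [hle j y y']
    · rw [dist_comm]
      linarith [hle j y' y]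
  · intro x hx
    have hkε : 0 ≤ k * ε := by simpa using hg x hx x hx
    refine EuclideanSpace.dist_le_sqrt_mul hkε fun j => ?_
    rw [Real.dist_eq, abs_sub_le_iff]
    constructor
    · have := ciInf_le (hbdd j (g x)) ⟨x, hx⟩
      have h2 : φ j (g x) ⟨x, hx⟩ = x j := by simp [φ]
      simp only
      linarith
    · rw [sub_le_comm]
      refine le_ciInf fun z => ?_
      have h1 := hg x hx z z.2
      have h2 := (abs_le.1 (hcoord x z.1 j)).2
      simp only [φ]
      linarith

/-- Lipschitz maps that almost preserve the distances on a bi-Lipschitz image of a compact set of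
positive measure cannot make its measure small. -/
theorem exists_le_hausdorffMeasure_image {n : ℕ} {X : Type*} [MetricSpace X] {S : Set X}
    {K : Set (EuclideanSpace ℝ (Fin n))} (hK : IsCompact K) (hpos : 0 < μH[(n : ℝ)] K)
    {f : EuclideanSpace ℝ (Fin n) → X} {Λ k : ℝ≥0} (hf : LipschitzOnWith Λ f K)
    (hk : ∀ x ∈ K, ∀ y ∈ K, dist x y ≤ k * dist (f x) (f y)) (hS : MapsTo f K S) :
    ∃ c : ℝ≥0∞, 0 < c ∧ ∀ L : ℝ≥0, ∃ ε₀ : ℝ, 0 < ε₀ ∧ ∀ ε : ℝ, ε ≤ ε₀ →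
      ∀ (Y : Type*) [MetricSpace Y] [MeasurableSpace Y] [BorelSpace Y] (σ : X → Y),
        LipschitzWith L σ →
        (∀ x ∈ S, ∀ y ∈ S, |dist x y - dist (σ x) (σ y)| < ε) →
        c ≤ μH[(n : ℝ)] (σ '' S) := by
  have hn : (Module.finrank ℝ (EuclideanSpace ℝ (Fin n))) = n := finrank_euclideanSpace_fin
  have hhaar : (μH[(n : ℝ)] : Measure (EuclideanSpace ℝ (Fin n))).IsAddHaarMeasure := by
    have := isAddHaarMeasure_hausdorffMeasure (E := EuclideanSpace ℝ (Fin n))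
    rwa [hn] at this
  set μ : Measure (EuclideanSpace ℝ (Fin n)) := μH[(n : ℝ)] with hμ
  have hfin : μ K ≠ ⊤ := hK.measure_lt_top.ne
  set D : ℝ≥0 := NNReal.sqrt n * k + 1 with hD
  have hD0 : (D : ℝ≥0∞) ^ n ≠ 0 := by simp [hD]
  have hDt : (D : ℝ≥0∞) ^ n ≠ ⊤ := ENNReal.pow_ne_top ENNReal.coe_ne_top
  refine ⟨μ K / 2 / D ^ n, ENNReal.div_pos (ENNReal.half_pos hpos.ne').ne' hDt, fun L => ?_⟩
  set C : ℝ≥0 := (NNReal.sqrt n * k) * (L * Λ)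
  set Q : ℝ≥0∞ := ((lipschitzExtensionConstant (EuclideanSpace ℝ (Fin n)) * max C 2 : ℝ≥0) : ℝ≥0∞)
    ^ n
  have hQt : Q ≠ ⊤ := ENNReal.pow_ne_top ENNReal.coe_ne_top
  obtain ⟨U, hKU, hUo, hUb, hUK⟩ : ∃ U : Set (EuclideanSpace ℝ (Fin n)), K ⊆ U ∧ IsOpen U ∧
      Bornology.IsBounded U ∧ Q * μ (U \ K) ≤ μ K / 2 := by
    obtain ⟨V, hKV, hVo, -, hV⟩ := hK.measurableSet.exists_isOpen_sdiff_lt hfin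
      (ε := μ K / 2 / Q) (ENNReal.div_pos (ENNReal.half_pos hpos.ne').ne' hQt).ne'
    obtain ⟨R, hR⟩ := hK.isBounded.subset_ball 0
    refine ⟨V ∩ ball 0 R, subset_inter hKV hR, hVo.inter isOpen_ball,
      isBounded_ball.subset inter_subset_right, ?_⟩
    calc Q * μ ((V ∩ ball 0 R) \ K) ≤ Q * (μ K / 2 / Q) := by
          gcongr
          exact (measure_mono (sdiff_subset_sdiff_left inter_subset_left)).trans hV.le
      _ ≤ μ K / 2 := ENNReal.mul_div_le
  obtain ⟨τ, hτ0, hτ⟩ := hK.exists_thickening_subset_open hUo hKU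
  have hDpos : 0 < (D : ℝ) := by positivity
  refine ⟨τ / D, by positivity, ?_⟩
  intro ε hε Y _ _ _ σ hσ hdist
  have hg : ∀ x ∈ K, ∀ x' ∈ K, dist x x' ≤ k * (dist ((σ ∘ f) x) ((σ ∘ f) x') + ε) := by
    intro x hx x' hx'
    refine (hk x hx x' hx').trans ?_
    gcongr
    have := (abs_lt.1 (hdist _ (hS hx) _ (hS hx'))).2
    simp only [Function.comp]
    linarith
  obtain ⟨h, hhL, hh⟩ := exists_lipschitzWith_dist_le hK.isBounded hg
  have hF : LipschitzOnWith C (h ∘ σ ∘ f) K :=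
    hhL.comp_lipschitzOnWith (hσ.comp_lipschitzOnWith hf)
  have hclose : ∀ x ∈ K, dist ((h ∘ σ ∘ f) x) x ≤ τ := by
    intro x hx
    have hε0 : 0 ≤ ε :=
      (abs_nonneg _).trans (hdist _ (hS hx) _ (hS hx)).le
    calc dist (h ((σ ∘ f) x)) x ≤ √n * (k * ε) := hh x hx
      _ = (√n * k) * ε := by ring
      _ ≤ D * (τ / D) := by
        have : √n * k ≤ (D : ℝ) := by simp [hD]
        gcongr
      _ = τ := by field_simp
  have hτ' : ∀ x ∈ K, ∀ y ∉ U, τ ≤ dist x y := by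
    intro x hx y hy
    by_contra! hlt
    exact hy (hτ (mem_thickening_iff.2 ⟨x, hx, by rwa [dist_comm]⟩))
  have key := hausdorffMeasure_le_image_add_of_dist_le hUb hKU hF hτ' hclose
  rw [hn, ← hμ] at key
  have h1 : μ K / 2 + μ K / 2 ≤ μ ((h ∘ σ ∘ f) '' K) + μ K / 2 := by
    rw [ENNReal.add_halves]
    exact (measure_mono hKU).trans (key.trans (by gcongr))
  have h2 : μ K / 2 ≤ μ ((h ∘ σ ∘ f) '' K) :=
    (ENNReal.add_le_add_iff_right (ENNReal.div_ne_top hfin (by simp))).1 h1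
  have h3 : μ ((h ∘ σ ∘ f) '' K) ≤ (D : ℝ≥0∞) ^ n * μH[(n : ℝ)] (σ '' S) := by
    have h4 := (hhL.weaken (le_self_add : _ ≤ D)).hausdorffMeasure_image_le
      (d := n) (by positivity) (σ '' S)
    rw [ENNReal.rpow_natCast] at h4
    refine le_trans (measure_mono ?_) h4
    rintro _ ⟨x, hx, rfl⟩
    exact ⟨σ (f x), ⟨f x, hS hx, rfl⟩, rfl⟩
  rw [ENNReal.div_le_iff' hD0 hDt]
  exact h2.trans h3

end Stability

lemma LipschitzWith.abs_lineDeriv_le {E : Type*} [NormedAddCommGroup E] [NormedSpace ℝ E]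
    {u : E → ℝ} {Λ : ℝ≥0} (hu : LipschitzWith Λ u) (z v : E) :
    |lineDeriv ℝ u z v| ≤ Λ * ‖v‖ := by
  have := norm_lineDeriv_le_of_lipschitz ℝ hu (x₀ := z) (v := v)
  simpa using this

lemma LipschitzWith.abs_sub_le_of_volume_le {E : Type*} [NormedAddCommGroup E] [NormedSpace ℝ E]
    [MeasurableSpace E] [BorelSpace E] {u : E → ℝ} {Λ : ℝ≥0} (hu : LipschitzWith Λ u) {A : Set E}
    (hA : MeasurableSet A) {z v : E} {t θ η : ℝ} (ht : 0 ≤ t) (hη : 0 ≤ η)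
    (hθ : 0 ≤ θ) (hAθ : ∀ y ∈ A, |lineDeriv ℝ u y v| ≤ θ)
    (hvol : volume {s ∈ Ioc 0 t | z + s • v ∉ A} ≤ ENNReal.ofReal (η * t)) :
    |u (z + t • v) - u z| ≤ (θ + Λ * ‖v‖ * η) * t := by
  set g : ℝ → ℝ := fun s => u (z + s • v)
  have hg : LipschitzWith (Λ * ‖v‖₊) g := by
    apply LipschitzWith.of_dist_le_mul
    intro s s'
    refine (hu.dist_le_mul _ _).trans ?_
    rw [dist_add_left, dist_eq_norm, ← sub_smul, norm_smul, dist_eq_norm]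
    simp only [NNReal.coe_mul, coe_nnnorm]
    apply le_of_eq
    ring
  have hder : ∀ s, deriv g s = lineDeriv ℝ u (z + s • v) v := by
    intro s
    have h1 : (fun r : ℝ => u (z + s • v + r • v)) = fun r => g (s + r) := by
      ext r
      simp only [g]
      rw [add_smul, add_assoc]
    rw [lineDeriv, h1, deriv_comp_const_add, add_zero]
  have hftc := (hg.lipschitzOnWith (s := uIcc 0 t)).absolutelyContinuousOnInterval
    |>.integral_deriv_eq_sub
  have hbound : ∀ s, |deriv g s| ≤ Λ * ‖v‖ := fun s => by
    rw [hder]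
    exact hu.abs_lineDeriv_le _ _
  set W : Set ℝ := {s | z + s • v ∉ A} with hW
  have hWm : MeasurableSet W := by
    have : Measurable fun s : ℝ => z + s • v := by
      apply Continuous.measurable
      fun_prop
    exact this hA.compl
  have hpt : ∀ s, |deriv g s| ≤ θ + W.indicator (fun _ => Λ * ‖v‖) s := by
    intro s
    by_cases hs : s ∈ W
    · rw [indicator_of_mem hs]
      linarith [hbound s]
    · rw [indicator_of_notMem hs, add_zero, hder]
      exact hAθ _ (not_not.1 hs)
  have hvolr : volume.real (W ∩ Ioc 0 t) ≤ η * t := by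
    apply ENNReal.toReal_le_of_le_ofReal (by positivity)
    refine le_trans (measure_mono ?_) hvol
    rintro s ⟨h1, h2⟩
    exact ⟨h2, h1⟩
  have e0 : u (z + t • v) - u z = ∫ s in 0..t, deriv g s := by
    rw [hftc]
    simp [g]
  rw [e0, ← Real.norm_eq_abs]
  have hI : IntegrableOn (W.indicator (fun _ => (Λ : ℝ) * ‖v‖)) (Ioc 0 t) :=
    (integrableOn_const (by simp)).indicator hWm
  have hθI : IntegrableOn (fun _ : ℝ => θ) (Ioc 0 t) := integrableOn_const (by simp)
  rw [intervalIntegral.integral_of_le ht]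
  calc ‖∫ s in Ioc 0 t, deriv g s‖
      ≤ ∫ s in Ioc 0 t, (θ + W.indicator (fun _ => (Λ : ℝ) * ‖v‖) s) := by
        apply norm_integral_le_of_norm_le (hθI.add hI)
        exact Eventually.of_forall hpt
    _ = θ * t + Λ * ‖v‖ * volume.real (W ∩ Ioc 0 t) := by
        rw [integral_add hθI hI, integral_indicator hWm, Measure.restrict_restrict hWm]
        simp [ht, mul_comm]
    _ ≤ θ * t + Λ * ‖v‖ * (η * t) := by gcongr
    _ = _ := by ring

section MetricDerivative

variable {E : Type*} [NormedAddCommGroup E] [NormedSpace ℝ E] [FiniteDimensional ℝ E]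
  [MeasurableSpace E] [BorelSpace E]

/-- If `A` fills most of a ball around `x`, then some translate of the segment `[0, t • v]`
starting close to `x` mostly stays inside `A`. -/
lemma exists_mem_closedBall_volume_le (μ : Measure E) [μ.IsAddHaarMeasure] {A : Set E}
    (hA : MeasurableSet A) (x v : E) {ρ t : ℝ} (hρ : 0 < ρ) {η : ℝ≥0∞}
    (h : μ (Aᶜ ∩ closedBall x (ρ + t * ‖v‖)) ≤ η * μ (closedBall x ρ)) :
    ∃ z ∈ closedBall x ρ, volume {s ∈ Ioc 0 t | z + s • v ∉ A} ≤ η * ENNReal.ofReal t := by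
  have hB0 : μ (closedBall x ρ) ≠ 0 := (measure_closedBall_pos μ x hρ).ne'
  have hBt : μ (closedBall x ρ) ≠ ⊤ := measure_closedBall_lt_top.ne
  have hmeas : MeasurableSet {p : E × ℝ | p.1 + p.2 • v ∈ Aᶜ} := by
    have : Measurable fun p : E × ℝ => p.1 + p.2 • v := by
      apply Continuous.measurable
      fun_prop
    exact this hA.compl
  set ν : Measure ℝ := volume.restrict (Ioc 0 t)
  have hν : ∀ z, volume {s ∈ Ioc 0 t | z + s • v ∉ A} = ν {s | z + s • v ∈ Aᶜ} := by
    intro z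
    have hm : MeasurableSet {s : ℝ | z + s • v ∈ Aᶜ} := measurable_prodMk_left hmeas
    rw [Measure.restrict_apply hm, inter_comm]
    rfl
  have hfm : Measurable fun z => ν {s | z + s • v ∈ Aᶜ} := measurable_measure_prodMk_left hmeas
  obtain ⟨z, hz, hzle⟩ := exists_le_setLAverage hB0 hBt hfm.aemeasurable
  refine ⟨z, hz, ?_⟩
  rw [hν]
  refine hzle.trans ?_
  rw [setLAverage_eq]
  apply ENNReal.div_le_of_le_mul
  have hswap : ∫⁻ z in closedBall x ρ, ν {s | z + s • v ∈ Aᶜ} ∂μ =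
      ∫⁻ s, (μ.restrict (closedBall x ρ)) {z | z + s • v ∈ Aᶜ} ∂ν := by
    have h1 := Measure.prod_apply (μ := μ.restrict (closedBall x ρ)) (ν := ν) hmeas
    have h2 := Measure.prod_apply_symm (μ := μ.restrict (closedBall x ρ)) (ν := ν) hmeas
    exact h1.symm.trans h2
  rw [hswap]
  calc ∫⁻ s, (μ.restrict (closedBall x ρ)) {z | z + s • v ∈ Aᶜ} ∂ν
      ≤ ∫⁻ _s, η * μ (closedBall x ρ) ∂ν := by
        apply setLIntegral_mono' measurableSet_Ioc
        intro s hs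
        refine le_trans ?_ h
        have hm : MeasurableSet {z : E | z + s • v ∈ Aᶜ} := measurable_prodMk_right hmeas
        rw [Measure.restrict_apply hm,
          ← measure_preimage_add_right μ (s • v) (Aᶜ ∩ closedBall x (ρ + t * ‖v‖))]
        refine measure_mono ?_
        rintro z ⟨hz1, hz2⟩
        refine ⟨hz1, ?_⟩
        rw [mem_closedBall] at hz2 ⊢
        calc dist (z + s • v) x ≤ dist (z + s • v) z + dist z x := dist_triangle _ _ _
          _ ≤ t * ‖v‖ + ρ := by
            gcongr
            rw [dist_self_add_left, norm_smul, Real.norm_of_nonneg hs.1.le]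
            gcongr
            exact hs.2
          _ = _ := add_comm _ _
    _ = η * ENNReal.ofReal t * μ (closedBall x ρ) := by
        simp [ν, mul_right_comm]

/-- At almost every point where all directional derivatives of a family of Lipschitz functions are
small, the family varies uniformly little in this direction. -/
lemma ae_exists_forall_abs_sub_le_of_pos (μ : Measure E) [μ.IsAddHaarMeasure] {ι : Type*}
    [Countable ι] {u : ι → E → ℝ} {Λ : ℝ≥0} (hu : ∀ i, LipschitzWith Λ (u i)) {v : E}
    (hv : ‖v‖ = 1) {θ : ℝ} (hθ : 0 < θ) :
    ∀ᵐ x ∂μ, (∀ i, |lineDeriv ℝ (u i) x v| ≤ θ) → ∃ r > 0, ∀ t : ℝ, 0 ≤ t → t < r → ∀ i,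
      |u i (x + t • v) - u i x| ≤ (3 * Λ + 1) * θ * t := by
  set A : Set E := {x | ∀ i, |lineDeriv ℝ (u i) x v| ≤ θ} with hAdef
  have hA : MeasurableSet A := by
    rw [hAdef, ofPred_forall]
    refine MeasurableSet.iInter fun i => ?_
    exact measurableSet_le (measurable_lineDeriv (hu i).continuous).norm measurable_const
  set d := Module.finrank ℝ E
  set κ : ℝ := θ * (θ / (θ + 1)) ^ d with hκ
  have hκ0 : 0 < κ := by positivity
  filter_upwards [Besicovitch.ae_tendsto_measure_inter_div_of_measurableSet μ hA.compl]
    with x hx hxA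
  rw [indicator_of_notMem (fun h : x ∈ Aᶜ => h hxA)] at hx
  have hev := (tendsto_order.1 hx).2 (ENNReal.ofReal κ) (by simpa using hκ0)
  obtain ⟨r, hr0, hr⟩ := mem_nhdsGT_iff_exists_Ioo_subset.1 hev
  have hr0' : 0 < r := hr0
  refine ⟨r / (θ + 1), by positivity, fun t ht htr i => ?_⟩
  rcases ht.eq_or_lt with rfl | ht0
  · simp
  have hR : (θ * t + t * ‖v‖) ∈ Ioo 0 r := by
    rw [hv]
    constructor
    · positivity
    · rw [lt_div_iff₀ (by positivity)] at htr
      linarith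
  have h1 : μ (Aᶜ ∩ closedBall x (θ * t + t * ‖v‖)) / μ (closedBall x (θ * t + t * ‖v‖)) <
      ENNReal.ofReal κ := hr hR
  have hscale : ENNReal.ofReal κ * μ (closedBall x (θ * t + t * ‖v‖)) =
      ENNReal.ofReal θ * μ (closedBall x (θ * t)) := by
    rw [Measure.addHaar_closedBall μ x hR.1.le, Measure.addHaar_closedBall μ x (by positivity),
      ← mul_assoc, ← mul_assoc, ← ENNReal.ofReal_mul hκ0.le, ← ENNReal.ofReal_mul hθ.le, hv, hκ]
    congr 2
    rw [mul_assoc, ← mul_pow]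
    congr 2
    field_simp
  have h2 : μ (Aᶜ ∩ closedBall x (θ * t + t * ‖v‖)) ≤
      ENNReal.ofReal θ * μ (closedBall x (θ * t)) := by
    rw [← hscale]
    have hb0 : μ (closedBall x (θ * t + t * ‖v‖)) ≠ 0 := (measure_closedBall_pos μ x hR.1).ne'
    have hbt : μ (closedBall x (θ * t + t * ‖v‖)) ≠ ⊤ := measure_closedBall_lt_top.ne
    exact (ENNReal.div_le_iff hb0 hbt).1 h1.le
  obtain ⟨z, hz, hzv⟩ := exists_mem_closedBall_volume_le μ hA x v (by positivity) h2
  rw [← ENNReal.ofReal_mul hθ.le] at hzv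
  have h3 := (hu i).abs_sub_le_of_volume_le hA ht hθ.le hθ.le (fun y hy => hy i) hzv
  rw [hv, mul_one] at h3
  have h4 := (hu i).dist_le_mul (x + t • v) (z + t • v)
  have h5 := (hu i).dist_le_mul z x
  rw [dist_add_right, dist_comm x z, Real.dist_eq] at h4
  rw [Real.dist_eq] at h5
  have h6 : (Λ : ℝ) * dist z x ≤ Λ * (θ * t) := by
    gcongr
    exact mem_closedBall.1 hz
  calc |u i (x + t • v) - u i x|
      = |(u i (x + t • v) - u i (z + t • v)) + (u i (z + t • v) - u i z) + (u i z - u i x)| := by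
        congr 1; ring
    _ ≤ _ := abs_add_three _ _ _
    _ ≤ Λ * (θ * t) + (θ + Λ * θ) * t + Λ * (θ * t) := by
        gcongr
        · exact h4.trans h6
        · exact h5.trans h6
    _ = _ := by ring

lemma ae_exists_forall_abs_sub_le (μ : Measure E) [μ.IsAddHaarMeasure] {ι : Type*}
    [Countable ι] {u : ι → E → ℝ} {Λ : ℝ≥0} (hu : ∀ i, LipschitzWith Λ (u i)) {v : E}
    (hv : ‖v‖ = 1) {θ : ℝ} (hθ : 0 < θ) :
    ∀ᵐ x ∂μ, (∀ i, |lineDeriv ℝ (u i) x v| ≤ θ) → ∃ r > 0, ∀ t : ℝ, |t| < r → ∀ i,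
      |u i (x + t • v) - u i x| ≤ (3 * Λ + 1) * θ * |t| := by
  have hv' : ‖-v‖ = 1 := by rwa [norm_neg]
  filter_upwards [ae_exists_forall_abs_sub_le_of_pos μ hu hv hθ,
    ae_exists_forall_abs_sub_le_of_pos μ hu hv' hθ] with x h1 h2 hx
  obtain ⟨r₁, hr₁, h1⟩ := h1 hx
  obtain ⟨r₂, hr₂, h2⟩ := h2 fun i => by
    rw [lineDeriv_neg, abs_neg]
    exact hx i
  refine ⟨min r₁ r₂, lt_min hr₁ hr₂, fun t ht i => ?_⟩
  rcases le_total 0 t with h0 | h0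
  · rw [abs_of_nonneg h0] at ht ⊢
    exact h1 t h0 (ht.trans_le (min_le_left _ _)) i
  · rw [abs_of_nonpos h0] at ht ⊢
    have := h2 (-t) (by linarith) (ht.trans_le (min_le_right _ _)) i
    rwa [neg_smul_neg] at this

end MetricDerivative

section Squeeze

lemma measure_image_le_of_forall_subset {E X ι : Type*} [MeasurableSpace E] [MeasurableSpace X]
    [Countable ι] {μ : Measure E} {ν : Measure X} {f : E → X} {D B : Set E} {P : ι → Set E}
    {c : ℝ≥0∞} (hP : ∀ q, MeasurableSet (P q)) (hB : MeasurableSet B) (hDB : D ⊆ B)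
    (h : ∀ q, ∀ s ⊆ D, s ⊆ P q → ν (f '' s) ≤ c * μ s) (hnull : ν (f '' (D \ ⋃ q, P q)) = 0) :
    ν (f '' D) ≤ c * μ B := by
  cases isEmpty_or_nonempty ι with
  | inl hι =>
    rw [iUnion_of_empty, sdiff_empty] at hnull
    rw [hnull]
    exact bot_le
  | inr hι =>
    obtain ⟨e, he⟩ := exists_surjective_nat ι
    set Q : ℕ → Set E := disjointed (P ∘ e) with hQ
    have hQU : ⋃ m, Q m = ⋃ q, P q := by
      rw [hQ, iUnion_disjointed]
      exact he.iUnion_comp P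
    have hQm : ∀ m, MeasurableSet (Q m) := fun m => MeasurableSet.disjointed (fun m => hP _) m
    have hD : f '' D ⊆ f '' (D \ ⋃ q, P q) ∪ ⋃ m, f '' (D ∩ Q m) := by
      rw [← image_iUnion, ← inter_iUnion, hQU, ← image_union, sdiff_union_inter]
    calc ν (f '' D) ≤ ν (f '' (D \ ⋃ q, P q) ∪ ⋃ m, f '' (D ∩ Q m)) := measure_mono hD
      _ ≤ ν (f '' (D \ ⋃ q, P q)) + ν (⋃ m, f '' (D ∩ Q m)) := measure_union_le _ _
      _ = ν (⋃ m, f '' (D ∩ Q m)) := by rw [hnull, zero_add]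
      _ ≤ ∑' m, ν (f '' (D ∩ Q m)) := measure_iUnion_le _
      _ ≤ ∑' m, c * μ (B ∩ Q m) := by
        refine ENNReal.tsum_le_tsum fun m => ?_
        refine (h (e m) _ inter_subset_left
          (inter_subset_right.trans (disjointed_le (P ∘ e) m))).trans ?_
        gcongr
      _ = c * μ (⋃ m, B ∩ Q m) := by
        rw [ENNReal.tsum_mul_left, measure_iUnion]
        · intro i j hij
          exact (disjoint_disjointed (P ∘ e) hij).mono inter_subset_right inter_subset_right
        · exact fun m => hB.inter (hQm m)
      _ ≤ c * μ B := by
        gcongr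
        exact iUnion_subset fun m => inter_subset_left

lemma le_norm_transvection {E : Type*} [NormedAddCommGroup E] [InnerProductSpace ℝ E]
    (v z : E) (hv : ‖v‖ = 1) {θ : ℝ} (hθ : 0 ≤ θ) :
    ‖z - inner ℝ v z • v‖ ≤ ‖LinearMap.transvection ((θ - 1) • (innerSL ℝ v).toLinearMap) v z‖ ∧
    θ * |inner ℝ v z| ≤ ‖LinearMap.transvection ((θ - 1) • (innerSL ℝ v).toLinearMap) v z‖ := by
  have hT : LinearMap.transvection ((θ - 1) • (innerSL ℝ v).toLinearMap) v z =
      (z - inner ℝ v z • v) + (θ * inner ℝ v z) • v := by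
    rw [LinearMap.transvection.apply]
    simp only [LinearMap.smul_apply, ContinuousLinearMap.coe_coe, innerSL_apply_apply, smul_eq_mul]
    module
  have horth : inner ℝ (z - inner ℝ v z • v) ((θ * inner ℝ v z) • v) = 0 := by
    rw [inner_smul_right, inner_sub_left, inner_smul_left, real_inner_self_eq_norm_sq, hv,
      real_inner_comm]
    simp
  have hsq := norm_add_sq_eq_norm_sq_add_norm_sq_of_inner_eq_zero _ _ horth
  rw [hT]
  have h2 : ‖(θ * inner ℝ v z) • v‖ = θ * |inner ℝ v z| := by
    rw [norm_smul, hv, mul_one, Real.norm_eq_abs, abs_mul, abs_of_nonneg hθ]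
  rw [h2] at hsq
  constructor
  · apply abs_le_of_sq_le_sq' _ (norm_nonneg _) |>.2
    nlinarith [mul_self_nonneg (θ * |inner ℝ v z|)]
  · apply abs_le_of_sq_le_sq' _ (norm_nonneg _) |>.2
    nlinarith [mul_self_nonneg ‖z - inner ℝ v z • v‖]

lemma isClosed_setOf_forall_abs_sub_le {E : Type*} [NormedAddCommGroup E]
    [NormedSpace ℝ E] {ι : Type*} {u : ι → E → ℝ} {Λ : ℝ≥0}
    (hu : ∀ i, LipschitzWith Λ (u i)) (v : E) (r c : ℝ) :
    IsClosed {x | ∀ t : ℝ, |t| < r → ∀ i, |u i (x + t • v) - u i x| ≤ c * |t|} := by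
  simp only [ofPred_forall]
  refine isClosed_iInter fun t => isClosed_iInter fun _ => isClosed_iInter fun i => ?_
  have := (hu i).continuous
  exact isClosed_le (by fun_prop) continuous_const

variable {E : Type*} [NormedAddCommGroup E] [InnerProductSpace ℝ E] [FiniteDimensional ℝ E]
  [MeasurableSpace E] [BorelSpace E] {X : Type*} [MetricSpace X] [MeasurableSpace X] [BorelSpace X]

lemma hausdorffMeasure_image_le_det {f : E → X} {s : Set E} (T : E →ₗ[ℝ] E) {C : ℝ≥0}
    (h : ∀ x ∈ s, ∀ y ∈ s, dist (f x) (f y) ≤ C * ‖T (x - y)‖) :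
    μH[(Module.finrank ℝ E : ℝ)] (f '' s) ≤ (C : ℝ≥0∞) ^ (Module.finrank ℝ E : ℝ) *
      (ENNReal.ofReal |LinearMap.det T| * μH[(Module.finrank ℝ E : ℝ)] s) := by
  rw [← Measure.addHaar_image_linearMap]
  have hinv : ∀ p ∈ T '' s, Function.invFunOn T s p ∈ s ∧ T (Function.invFunOn T s p) = p :=
    fun p hp => ⟨Function.invFunOn_mem hp, Function.invFunOn_eq hp⟩
  have hg : LipschitzOnWith C (f ∘ Function.invFunOn T s) (T '' s) := by
    apply LipschitzOnWith.of_dist_le_mul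
    intro p hp q hq
    refine (h _ (hinv p hp).1 _ (hinv q hq).1).trans_eq ?_
    rw [map_sub, (hinv p hp).2, (hinv q hq).2, dist_eq_norm]
  refine le_trans (measure_mono ?_) (hg.hausdorffMeasure_image_le (by positivity))
  rintro _ ⟨x, hx, rfl⟩
  refine ⟨T x, mem_image_of_mem _ hx, ?_⟩
  have h1 := hinv (T x) (mem_image_of_mem _ hx)
  apply dist_le_zero.1
  refine (h _ h1.1 _ hx).trans_eq ?_
  rw [map_sub, h1.2, sub_self, norm_zero, mul_zero]

/-- If a map varies little in the direction `v`, then it shrinks measure. -/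
lemma hausdorffMeasure_image_le_of_abs_sub_le {ι : Type*} {u : ι → E → ℝ} {Λ C : ℝ≥0}
    (hu : ∀ i, LipschitzWith Λ (u i)) {f : E → X} {s : Set E}
    (hf : ∀ x ∈ s, ∀ y ∈ s, ∀ c, 0 ≤ c → (∀ i, |u i x - u i y| ≤ c) → dist (f x) (f y) ≤ c)
    {v : E} (hv : ‖v‖ = 1) {θ r : ℝ} (hθ : 0 ≤ θ) (hs : ∀ x ∈ s, ∀ y ∈ s, dist x y < r)
    (h : ∀ x ∈ s, ∀ t : ℝ, |t| < r → ∀ i, |u i (x + t • v) - u i x| ≤ C * θ * |t|) :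
    μH[(Module.finrank ℝ E : ℝ)] (f '' s) ≤ ((Λ + C : ℝ≥0) : ℝ≥0∞) ^ (Module.finrank ℝ E : ℝ) *
      (ENNReal.ofReal θ * μH[(Module.finrank ℝ E : ℝ)] s) := by
  set T := LinearMap.transvection ((θ - 1) • (innerSL ℝ v).toLinearMap) v with hTdef
  have hdet : |LinearMap.det T| = θ := by
    rw [hTdef, LinearMap.transvection.det]
    simp [hv, abs_of_nonneg hθ]
  rw [← hdet]
  refine hausdorffMeasure_image_le_det T fun y hy x hx => hf y hy x hx _ (by positivity) fun i => ?_
  obtain ⟨h1, h2⟩ := le_norm_transvection v (y - x) hv hθ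
  rw [← hTdef] at h1 h2
  set t : ℝ := inner ℝ v (y - x) with ht
  have htr : |t| < r := by
    refine lt_of_le_of_lt ?_ (hs y hy x hx)
    rw [dist_eq_norm]
    simpa [hv] using abs_real_inner_le_norm v (y - x)
  have h3 := (hu i).dist_le_mul y (x + t • v)
  rw [dist_eq_norm y, ← sub_sub, Real.dist_eq] at h3
  calc |u i y - u i x| ≤ |u i y - u i (x + t • v)| + |u i (x + t • v) - u i x| :=
        abs_sub_le _ _ _
    _ ≤ Λ * ‖y - x - t • v‖ + C * θ * |t| := add_le_add h3 (h x hx t htr i)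
    _ = Λ * ‖y - x - t • v‖ + C * (θ * |t|) := by ring
    _ ≤ Λ * ‖T (y - x)‖ + C * ‖T (y - x)‖ := by gcongr
    _ = _ := by push_cast; ring

lemma hausdorffMeasure_image_le_of_fderiv_eq_zero {ι : Type*} [Countable ι] {u : ι → E → ℝ}
    {Λ Λ' : ℝ≥0} (hu : ∀ i, LipschitzWith Λ (u i)) {f : E → X} {D : Set E}
    (hfΛ : LipschitzOnWith Λ' f D)
    (hf : ∀ x ∈ D, ∀ y ∈ D, ∀ c, 0 ≤ c → (∀ i, |u i x - u i y| ≤ c) → dist (f x) (f y) ≤ c)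
    (hD : ∀ x ∈ D, ∃ v : E, ‖v‖ = 1 ∧ ∀ i, DifferentiableAt ℝ (u i) x ∧ fderiv ℝ (u i) x v = 0)
    {R θ : ℝ} (hDR : D ⊆ ball 0 R) (hθ : 0 < θ) :
    μH[(Module.finrank ℝ E : ℝ)] (f '' D) ≤
      ((Λ + (3 * Λ + 1) : ℝ≥0) : ℝ≥0∞) ^ (Module.finrank ℝ E : ℝ) *
      ENNReal.ofReal θ * μH[(Module.finrank ℝ E : ℝ)] (ball (0 : E) R) := by
  rcases D.eq_empty_or_nonempty with rfl | ⟨x₀, hx₀⟩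
  · simp
  obtain ⟨v₀, hv₀, -⟩ := hD x₀ hx₀
  have : Nonempty (sphere (0 : E) 1) := ⟨⟨v₀, by simpa using hv₀⟩⟩
  set w : ℕ → E := fun j => (TopologicalSpace.denseSeq (sphere (0 : E) 1) j : E) with hw
  have hw1 : ∀ j, ‖w j‖ = 1 := fun j => norm_eq_of_mem_sphere _
  set p : ℕ → E := TopologicalSpace.denseSeq E
  set P : ℕ × ℕ × ℕ → Set E := fun q =>
    {x | ∀ t : ℝ, |t| < 1 / ((q.2.1 : ℝ) + 1) → ∀ i,
      |u i (x + t • w q.1) - u i x| ≤ (3 * Λ + 1) * θ * |t|} ∩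
    closedBall (p q.2.2) (1 / ((q.2.1 : ℝ) + 1) / 4) with hP
  refine measure_image_le_of_forall_subset (P := P) (fun q => ?_) measurableSet_ball hDR ?_ ?_
  · exact ((isClosed_setOf_forall_abs_sub_le hu _ _ _).inter isClosed_closedBall).measurableSet
  · intro q s hsD hsP
    rw [mul_assoc]
    have hk : (0 : ℝ) < 1 / ((q.2.1 : ℝ) + 1) := by positivity
    refine hausdorffMeasure_image_le_of_abs_sub_le hu (fun x hx y hy => hf x (hsD hx) y (hsD hy))
      (hw1 q.1) hθ.le (r := 1 / ((q.2.1 : ℝ) + 1)) ?_ ?_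
    · intro x hx y hy
      have h1 := mem_closedBall.1 (hsP hx).2
      have h2 := mem_closedBall.1 (hsP hy).2
      linarith [dist_triangle_right x y (p q.2.2)]
    · intro x hx t ht i
      simpa using (hsP hx).1 t ht i
  · have hae : ∀ᵐ x ∂(μH[(Module.finrank ℝ E : ℝ)] : Measure E), ∀ j,
        (∀ i, |lineDeriv ℝ (u i) x (w j)| ≤ θ) → ∃ r > 0, ∀ t : ℝ, |t| < r → ∀ i,
          |u i (x + t • w j) - u i x| ≤ (3 * Λ + 1) * θ * |t| :=
      ae_all_iff.2 fun j => ae_exists_forall_abs_sub_le _ hu (hw1 j) hθ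
    have hN : μH[(Module.finrank ℝ E : ℝ)] (D \ ⋃ q, P q) = 0 := by
      refine measure_mono_null ?_ (ae_iff.1 hae)
      rintro x ⟨hxD, hxP⟩ hx
      apply hxP
      obtain ⟨v, hv, hxv⟩ := hD x hxD
      obtain ⟨j, hj⟩ := (TopologicalSpace.denseRange_denseSeq (sphere (0 : E) 1)).exists_dist_lt
        (⟨v, by simpa using hv⟩ : sphere (0 : E) 1) (ε := θ / (Λ + 1)) (by positivity)
      have hj' : ‖w j - v‖ < θ / (Λ + 1) := by
        rw [← dist_eq_norm, dist_comm]
        exact hj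
      obtain ⟨r, hr, hxr⟩ := hx j fun i => by
        obtain ⟨hd, h0⟩ := hxv i
        rw [hd.lineDeriv_eq_fderiv]
        have : fderiv ℝ (u i) x (w j) = fderiv ℝ (u i) x (w j - v) := by
          rw [map_sub, h0, sub_zero]
        rw [this, ← Real.norm_eq_abs]
        calc ‖fderiv ℝ (u i) x (w j - v)‖ ≤ ‖fderiv ℝ (u i) x‖ * ‖w j - v‖ :=
              ContinuousLinearMap.le_opNorm _ _
          _ ≤ (Λ + 1) * (θ / (Λ + 1)) := by
            gcongr
            exact (norm_fderiv_le_of_lipschitz ℝ (hu i)).trans (by simp)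
          _ = θ := by field_simp
      obtain ⟨k, hk⟩ := exists_nat_one_div_lt hr
      obtain ⟨m, hm⟩ := (TopologicalSpace.denseRange_denseSeq E).exists_dist_lt x
        (ε := 1 / ((k : ℝ) + 1) / 4) (by positivity)
      exact mem_iUnion.2 ⟨(j, k, m), fun t ht i => hxr t (ht.trans hk) i, hm.le⟩
    have := (hfΛ.mono (sdiff_subset (t := ⋃ q, P q))).hausdorffMeasure_image_le
      (d := Module.finrank ℝ E) (by positivity)
    rw [hN, mul_zero] at this
    exact le_antisymm this bot_le

/-- A Lipschitz map to a metric space sends the set of points where its metric derivative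
degenerates to a null set. -/
lemma hausdorffMeasure_image_eq_zero_of_fderiv_eq_zero {ι : Type*} [Countable ι] {u : ι → E → ℝ}
    {Λ Λ' : ℝ≥0} (hu : ∀ i, LipschitzWith Λ (u i)) {f : E → X} {D : Set E}
    (hfΛ : LipschitzOnWith Λ' f D)
    (hf : ∀ x ∈ D, ∀ y ∈ D, ∀ c, 0 ≤ c → (∀ i, |u i x - u i y| ≤ c) → dist (f x) (f y) ≤ c)
    (hD : ∀ x ∈ D, ∃ v : E, ‖v‖ = 1 ∧ ∀ i, DifferentiableAt ℝ (u i) x ∧ fderiv ℝ (u i) x v = 0) :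
    μH[(Module.finrank ℝ E : ℝ)] (f '' D) = 0 := by
  have hU : f '' D = ⋃ m : ℕ, f '' (D ∩ ball 0 (m : ℝ)) := by
    rw [← image_iUnion, ← inter_iUnion, iUnion_ball_nat, inter_univ]
  rw [hU, measure_iUnion_null_iff]
  intro m
  set K : ℝ≥0∞ := ((Λ + (3 * Λ + 1) : ℝ≥0) : ℝ≥0∞) ^ (Module.finrank ℝ E : ℝ) with hK
  set M : ℝ≥0∞ := μH[(Module.finrank ℝ E : ℝ)] (ball (0 : E) (m : ℝ)) with hM
  have hKt : K ≠ ⊤ := ENNReal.rpow_ne_top_of_nonneg (by positivity) ENNReal.coe_ne_top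
  have hMt : M ≠ ⊤ := measure_ball_lt_top.ne
  have hb : ∀ θ : ℝ, 0 < θ → μH[(Module.finrank ℝ E : ℝ)] (f '' (D ∩ ball 0 (m : ℝ))) ≤
      K * ENNReal.ofReal θ * M := fun θ hθ =>
    hausdorffMeasure_image_le_of_fderiv_eq_zero hu (hfΛ.mono inter_subset_left)
      (fun x hx y hy => hf x hx.1 y hy.1) (fun x hx => hD x hx.1) inter_subset_right hθ
  have hlim : Tendsto (fun θ : ℝ => K * ENNReal.ofReal θ * M) (𝓝[>] 0) (𝓝 0) := by
    have h0 : Tendsto (fun θ : ℝ => ENNReal.ofReal θ) (𝓝[>] 0) (𝓝 0) := by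
      have := (ENNReal.continuous_ofReal.tendsto 0).mono_left (nhdsWithin_le_nhds (s := Ioi 0))
      rwa [ENNReal.ofReal_zero] at this
    have := ENNReal.Tendsto.mul_const (ENNReal.Tendsto.const_mul h0 (Or.inr hKt)) (Or.inr hMt)
    simpa using this
  refine le_antisymm (ge_of_tendsto hlim ?_) bot_le
  filter_upwards [self_mem_nhdsWithin] with θ hθ using hb θ hθ

end Squeeze

section BiLipschitz

lemma LipschitzOnWith.exists_coordinates {E X : Type*} [PseudoMetricSpace E]
    [TopologicalSpace.SeparableSpace E] [PseudoMetricSpace X] {f : E → X} {A : Set E} {Λ : ℝ≥0}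
    (hf : LipschitzOnWith Λ f A) :
    ∃ u : ℕ → E → ℝ, (∀ i, LipschitzWith Λ (u i)) ∧ ∀ x ∈ A, ∀ y ∈ A,
      (∀ i, |u i x - u i y| ≤ dist (f x) (f y)) ∧
      ∀ c, (∀ i, |u i x - u i y| ≤ c) → dist (f x) (f y) ≤ c := by
  rcases A.eq_empty_or_nonempty with rfl | hA
  · exact ⟨fun _ _ => 0, fun _ => LipschitzWith.const' 0, by simp⟩
  have : Nonempty A := hA.to_subtype
  have : TopologicalSpace.SeparableSpace A :=
    (TopologicalSpace.IsSeparable.of_separableSpace A).separableSpace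
  set a : ℕ → A := TopologicalSpace.denseSeq A
  have hlip : ∀ i, LipschitzOnWith Λ (fun x => dist (f x) (f (a i))) A := fun i => by
    apply LipschitzOnWith.of_dist_le_mul
    intro x hx y hy
    exact (dist_dist_dist_le_left _ _ _).trans (hf.dist_le_mul x hx y hy)
  choose u hu huA using fun i => (hlip i).extend_real
  refine ⟨u, hu, fun x hx y hy => ⟨fun i => ?_, fun c hc => ?_⟩⟩
  · rw [← huA i hx, ← huA i hy]
    exact abs_dist_sub_le _ _ _
  · refine le_of_forall_pos_le_add fun ε hε => ?_
    obtain ⟨i, hi⟩ := (TopologicalSpace.denseRange_denseSeq A).exists_dist_lt ⟨x, hx⟩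
      (ε := ε / (2 * (Λ + 1))) (by positivity)
    have hi' : dist x (a i) < ε / (2 * (Λ + 1)) := hi
    have h1 : dist (f x) (f (a i)) ≤ ε / 2 := by
      calc dist (f x) (f (a i)) ≤ Λ * dist x (a i) := hf.dist_le_mul x hx _ (a i).2
        _ ≤ (Λ + 1) * (ε / (2 * (Λ + 1))) := by
          gcongr
          linarith
        _ = ε / 2 := by field_simp
    have h2 := hc i
    rw [← huA i hx, ← huA i hy] at h2
    have h3 := (abs_le.1 h2).1
    have h4 := dist_triangle_right (f x) (f y) (f (a i))
    linarith

lemma IsClosed.setOf_forall_dist_le {E X : Type*} [PseudoMetricSpace E] [PseudoMetricSpace X]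
    {f : E → X} {A : Set E} (hA : IsClosed A) (hf : ContinuousOn f A) (r C : ℝ) :
    IsClosed {x ∈ A | ∀ y ∈ A, dist x y < r → dist x y ≤ C * dist (f x) (f y)} := by
  have : {x ∈ A | ∀ y ∈ A, dist x y < r → dist x y ≤ C * dist (f x) (f y)} =
      A ∩ ⋂ y ∈ A, ({x ∈ A | r ≤ dist x y} ∪ {x ∈ A | dist x y ≤ C * dist (f x) (f y)}) := by
    ext x
    simp only [mem_ofPred_eq, mem_inter_iff, mem_iInter, mem_union]
    constructor
    · rintro ⟨hx, h⟩
      refine ⟨hx, fun y hy => ?_⟩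
      rcases le_or_gt r (dist x y) with h1 | h1
      · exact Or.inl ⟨hx, h1⟩
      · exact Or.inr ⟨hx, h y hy h1⟩
    · rintro ⟨hx, h⟩
      refine ⟨hx, fun y hy h1 => ?_⟩
      rcases h y hy with h2 | h2
      · exact absurd h1 (not_lt.2 h2.2)
      · exact h2.2
  rw [this]
  refine hA.inter (isClosed_biInter fun y _ => ?_)
  have hd : ContinuousOn (fun x => dist x y) A := by fun_prop
  exact (hA.isClosed_le continuousOn_const hd).union (hA.isClosed_le hd (by fun_prop))

variable {E : Type*} [NormedAddCommGroup E]

lemma exists_fderiv_eq_zero [NormedSpace ℝ E] [FiniteDimensional ℝ E] {X : Type*} [MetricSpace X]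
    {f : E → X} {A : Set E} {ι : Type*} {u : ι → E → ℝ} {x : E}
    (hu : ∀ i, ∀ y ∈ A, |u i y - u i x| ≤ dist (f x) (f y))
    (hd : ∀ i, DifferentiableAt ℝ (u i) x)
    (h : ∀ k : ℕ, ∃ y ∈ A, dist x y < 1 / ((k : ℝ) + 1) ∧
      ((k : ℝ) + 1) * dist (f x) (f y) < dist x y) :
    ∃ v : E, ‖v‖ = 1 ∧ ∀ i, fderiv ℝ (u i) x v = 0 := by
  choose y hyA hyx hy using h
  have hpos : ∀ k, 0 < ‖y k - x‖ := fun k => by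
    rw [← dist_eq_norm, dist_comm]
    exact lt_of_le_of_lt (by positivity) (hy k)
  set w : ℕ → E := fun k => ‖y k - x‖⁻¹ • (y k - x) with hw
  have hw1 : ∀ k, w k ∈ sphere (0 : E) 1 := fun k => by
    rw [mem_sphere_zero_iff_norm, hw, norm_smul, norm_inv, norm_norm,
      inv_mul_cancel₀ (hpos k).ne']
  obtain ⟨v, hv, φ, hφ, hlim⟩ := (isCompact_sphere (0 : E) 1).tendsto_subseq hw1
  refine ⟨v, mem_sphere_zero_iff_norm.1 hv, fun i => ?_⟩
  have h0 : Tendsto (fun k : ℕ => 1 / ((k : ℝ) + 1)) atTop (𝓝 0) :=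
    tendsto_one_div_add_atTop_nhds_zero_nat
  have hdlim : Tendsto (fun k => y k - x) atTop (𝓝 0) := by
    refine squeeze_zero_norm (fun k => ?_) h0
    rw [← dist_eq_norm, dist_comm]
    exact (hyx k).le
  have h1 := ((hd i).hasFDerivAt.hasFDerivWithinAt (s := univ)).lim
    (hdlim.comp hφ.tendsto_atTop) (Eventually.of_forall fun _ => mem_univ _) hlim
  have h2 : Tendsto (fun k => ‖y k - x‖⁻¹ • (u i (x + (y k - x)) - u i x)) atTop (𝓝 0) := by
    refine squeeze_zero_norm (fun k => ?_) h0
    have hk := hy k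
    rw [dist_comm x, dist_eq_norm (y k)] at hk
    rw [add_sub_cancel, norm_smul, norm_inv, norm_norm, Real.norm_eq_abs,
      inv_mul_le_iff₀ (hpos k), mul_one_div, le_div_iff₀ (by positivity), mul_comm]
    refine le_trans ?_ hk.le
    gcongr
    exact hu i _ (hyA k)
  exact tendsto_nhds_unique h1 (h2.comp hφ.tendsto_atTop)

/-- A Lipschitz map is locally bi-Lipschitz, up to a set with null image. -/
lemma LipschitzOnWith.hausdorffMeasure_image_sdiff_eq_zero [InnerProductSpace ℝ E]
    [FiniteDimensional ℝ E] [MeasurableSpace E] [BorelSpace E] {X : Type*} [MetricSpace X]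
    [MeasurableSpace X] [BorelSpace X] {f : E → X} {A : Set E} {Λ : ℝ≥0}
    (hf : LipschitzOnWith Λ f A) :
    μH[(Module.finrank ℝ E : ℝ)] (f '' (A \ ⋃ k : ℕ, {x ∈ A | ∀ y ∈ A,
      dist x y < 1 / ((k : ℝ) + 1) → dist x y ≤ ((k : ℝ) + 1) * dist (f x) (f y)})) = 0 := by
  obtain ⟨u, hu, huA⟩ := hf.exists_coordinates
  set G : Set E := ⋃ k : ℕ, {x ∈ A | ∀ y ∈ A,
      dist x y < 1 / ((k : ℝ) + 1) → dist x y ≤ ((k : ℝ) + 1) * dist (f x) (f y)} with hG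
  set N : Set E := {x | ¬ ∀ i, DifferentiableAt ℝ (u i) x} with hN
  have hN0 : μH[(Module.finrank ℝ E : ℝ)] N = 0 :=
    ae_iff.1 (ae_all_iff.2 fun i => (hu i).ae_differentiableAt)
  have h1 : μH[(Module.finrank ℝ E : ℝ)] (f '' (A ∩ N)) = 0 := by
    have := (hf.mono (inter_subset_left (t := N))).hausdorffMeasure_image_le
      (d := Module.finrank ℝ E) (by positivity)
    rw [measure_mono_null inter_subset_right hN0, mul_zero] at this
    exact le_antisymm this bot_le
  have h2 : μH[(Module.finrank ℝ E : ℝ)] (f '' ((A \ G) \ N)) = 0 := by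
    have hsub : (A \ G) \ N ⊆ A := fun x hx => hx.1.1
    refine hausdorffMeasure_image_eq_zero_of_fderiv_eq_zero hu (hf.mono hsub)
      (fun x hx y hy c _ => (huA x (hsub hx) y (hsub hy)).2 c) fun x hx => ?_
    have hxd : ∀ i, DifferentiableAt ℝ (u i) x := not_not.1 hx.2
    obtain ⟨v, hv, h0⟩ := exists_fderiv_eq_zero (f := f) (A := A) (u := u) (x := x)
      (fun i y hy => by rw [dist_comm]; exact (huA y hy x hx.1.1).1 i) hxd fun k => by
        by_contra! hk
        exact hx.1.2 (mem_iUnion.2 ⟨k, hx.1.1, hk⟩)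
    exact ⟨v, hv, fun i => ⟨hxd i, h0 i⟩⟩
  refine measure_mono_null ?_ (measure_union_null h1 h2)
  rw [← image_union]
  refine image_mono fun x hx => ?_
  by_cases hxN : x ∈ N
  · exact Or.inl ⟨hx.1, hxN⟩
  · exact Or.inr ⟨hx, hxN⟩

end BiLipschitz

section CompactPiece

lemma LipschitzOnWith.exists_extend_closure {E X : Type*} [PseudoEMetricSpace E] [EMetricSpace X]
    [CompleteSpace X] {f : E → X} {A : Set E} {Λ : ℝ≥0} (hf : LipschitzOnWith Λ f A) :
    ∃ g : E → X, LipschitzOnWith Λ g (closure A) ∧ EqOn g f A := by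
  have hlim : ∀ x ∈ closure A, ∃ y, Tendsto f (𝓝[A] x) (𝓝 y) := fun x hx => by
    have := mem_closure_iff_nhdsWithin_neBot.1 hx
    exact cauchy_map_iff_exists_tendsto.1 ((cauchy_nhds.mono nhdsWithin_le_nhds).map_of_le
      hf.uniformContinuousOn inf_le_right)
  have heq : EqOn (extendFrom A f) f A := extendFrom_extends hf.continuousOn
  refine ⟨extendFrom A f, LipschitzOnWith.closure
    (continuousOn_extendFrom Subset.rfl hlim) fun x hx y hy => ?_, heq⟩
  rw [heq hx, heq hy]
  exact hf hx hy

lemma ContinuousOn.measurableSet_inter_preimage {E X : Type*} [TopologicalSpace E]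
    [MeasurableSpace E] [BorelSpace E] [TopologicalSpace X] [MeasurableSpace X] [BorelSpace X]
    {f : E → X} {P : Set E} {t : Set X} (hf : ContinuousOn f P) (hP : MeasurableSet P)
    (ht : MeasurableSet t) : MeasurableSet (P ∩ f ⁻¹' t) := by
  rw [← Subtype.image_preimage_coe]
  have hm : Measurable fun x : P => f x := (continuousOn_iff_continuous_domRestrict.1 hf).measurable
  exact hP.subtype_image (hm ht)

/-- If the Lipschitz image of a closed set meets a measurable set in positive measure, then it does
so through a compact set of positive measure on which the map is bi-Lipschitz. -/
lemma LipschitzOnWith.exists_isCompact_dist_le {E : Type*} [NormedAddCommGroup E]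
    [InnerProductSpace ℝ E] [FiniteDimensional ℝ E] [MeasurableSpace E] [BorelSpace E] {X : Type*}
    [MetricSpace X] [MeasurableSpace X] [BorelSpace X] {f : E → X} {A : Set E} {Λ : ℝ≥0}
    (hf : LipschitzOnWith Λ f A) (hA : IsClosed A) {t : Set X} (ht : MeasurableSet t)
    (hpos : μH[(Module.finrank ℝ E : ℝ)] (f '' A ∩ t) ≠ 0) :
    ∃ K ⊆ A, IsCompact K ∧ MapsTo f K t ∧ 0 < μH[(Module.finrank ℝ E : ℝ)] K ∧
      ∃ k : ℝ≥0, ∀ x ∈ K, ∀ y ∈ K, dist x y ≤ k * dist (f x) (f y) := by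
  set G : ℕ → Set E := fun k => {x ∈ A | ∀ y ∈ A,
      dist x y < 1 / ((k : ℝ) + 1) → dist x y ≤ ((k : ℝ) + 1) * dist (f x) (f y)} with hG
  have hGA : ∀ k, G k ⊆ A := fun k x hx => hx.1
  set p : ℕ → E := TopologicalSpace.denseSeq E
  set P : ℕ × ℕ → Set E := fun q => G q.1 ∩ closedBall (p q.2) (1 / ((q.1 : ℝ) + 1) / 4) with hP
  have hPA : ∀ q, P q ⊆ A := fun q => inter_subset_left.trans (hGA _)
  have hPc : ∀ q, IsClosed (P q) := fun q =>
    (hA.setOf_forall_dist_le hf.continuousOn _ _).inter isClosed_closedBall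
  obtain ⟨q, hq⟩ : ∃ q, μH[(Module.finrank ℝ E : ℝ)] (f '' (P q ∩ f ⁻¹' t)) ≠ 0 := by
    by_contra! h
    apply hpos
    refine measure_mono_null ?_
      (measure_union_null hf.hausdorffMeasure_image_sdiff_eq_zero (measure_iUnion_null h))
    rintro _ ⟨⟨x, hx, rfl⟩, hxt⟩
    by_cases hxG : x ∈ ⋃ k, G k
    · right
      obtain ⟨k, hk⟩ := mem_iUnion.1 hxG
      obtain ⟨m, hm⟩ := (TopologicalSpace.denseRange_denseSeq E).exists_dist_lt x
        (ε := 1 / ((k : ℝ) + 1) / 4) (by positivity)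
      exact mem_iUnion.2 ⟨(k, m), x, ⟨⟨hk, hm.le⟩, hxt⟩, rfl⟩
    · exact Or.inl ⟨x, ⟨hx, hxG⟩, rfl⟩
  have hfP := hf.mono (hPA q)
  have hs : μH[(Module.finrank ℝ E : ℝ)] (P q ∩ f ⁻¹' t) ≠ 0 := fun h0 => by
    have := (hfP.mono (inter_subset_left (t := f ⁻¹' t))).hausdorffMeasure_image_le
      (d := Module.finrank ℝ E) (by positivity)
    rw [h0, mul_zero] at this
    exact hq (le_antisymm this bot_le)
  obtain ⟨K, hKs, hK, hK0⟩ := (hfP.continuousOn.measurableSet_inter_preimage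
    (hPc q).measurableSet ht).exists_lt_isCompact (pos_iff_ne_zero.2 hs)
  refine ⟨K, fun x hx => hPA q (hKs hx).1, hK, fun x hx => (hKs hx).2, hK0,
    (q.1 : ℝ≥0) + 1, fun x hx y hy => ?_⟩
  have hk : (0 : ℝ) < 1 / ((q.1 : ℝ) + 1) := by positivity
  have h1 := mem_closedBall.1 (hKs hx).1.2
  have h2 := mem_closedBall.1 (hKs hy).1.2
  have h3 := (hKs hx).1.1.2 y (hPA q (hKs hy).1) (by linarith [dist_triangle_right x y (p q.2)])
  simpa using h3

end CompactPiece

theorem stmt7 {X : Type*} [MetricSpace X] [CompleteSpace X] [MeasurableSpace X] [BorelSpace X]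
    (n : ℕ) (hn : 1 ≤ n) (S : Set X)
    (hrect : IsRectifiable n S) (hpos : 0 < μH[(n : ℝ)] S) :
    ∃ c : ℝ≥0∞, 0 < c ∧ ∀ L : ℝ≥0, 1 ≤ L → ∃ ε₀ : ℝ, 0 < ε₀ ∧
      ∀ ε : ℝ, 0 < ε → ε ≤ ε₀ →
      ∀ (Y : Type*) [MetricSpace Y] [MeasurableSpace Y] [BorelSpace Y] (σ : X → Y),
        LipschitzWith L σ →
        (∀ x ∈ S, ∀ y ∈ S, |dist x y - dist (σ x) (σ y)| < ε) →
        c ≤ μH[(n : ℝ)] (σ '' S) := by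
  obtain ⟨hS, A, f, hf, hSA⟩ := hrect
  obtain ⟨t, htS, ht, htae⟩ := hS.exists_measurable_subset_ae_eq
  rw [← measure_congr htae] at hpos
  obtain ⟨i, hi⟩ : ∃ i, μH[(n : ℝ)] (f i '' A i ∩ t) ≠ 0 := by
    by_contra! h
    refine hpos.ne' (measure_mono_null ?_ (measure_union_null hSA (measure_iUnion_null h)))
    intro x hx
    by_cases hxf : x ∈ ⋃ i, f i '' A i
    · obtain ⟨i, hi⟩ := mem_iUnion.1 hxf
      exact Or.inr (mem_iUnion.2 ⟨i, hi, hx⟩)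
    · exact Or.inl ⟨htS hx, hxf⟩
  obtain ⟨Λ, hΛ⟩ := hf i
  obtain ⟨g, hg, hgf⟩ := hΛ.exists_extend_closure
  have hfin : Module.finrank ℝ (EuclideanSpace ℝ (Fin n)) = n := finrank_euclideanSpace_fin
  have hgt : μH[(Module.finrank ℝ (EuclideanSpace ℝ (Fin n)) : ℝ)]
      (g '' closure (A i) ∩ t) ≠ 0 := by
    rw [hfin]
    refine fun h0 => hi (measure_mono_null (inter_subset_inter_left _ ?_) h0)
    rw [← hgf.image_eq]
    exact image_mono subset_closure
  obtain ⟨K, hKA, hK, hKt, hK0, k, hk⟩ := hg.exists_isCompact_dist_le isClosed_closure ht hgt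
  rw [hfin] at hK0
  obtain ⟨c, hc, h⟩ := exists_le_hausdorffMeasure_image hK hK0 (hg.mono hKA) hk (hKt.mono_right htS)
  refine ⟨c, hc, fun L _ => ?_⟩
  obtain ⟨ε₀, hε₀, h⟩ := h L
  exact ⟨ε₀, hε₀, fun ε _ hε Y _ _ _ σ hσ hd => h ε hε Y σ hσ hd⟩
end
end
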